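/- Under the Algorithm 1 setup with every Φ_{i,t} equal to the identity mapping and with stepsizes α_t = β_t = 1/t^κ, γ_t = 1/t^{1−κ} for a constant κ ∈ (0,1), for any T ∈ ℕ₊ the sequence x_T generated by Algorithm 1 satisfies Reg(x_T, x̌*_T) ≤ C₁ T^{max{1−κ, κ}} and ‖[Σ_{t=1}^T g_t(x_t)]_+‖ ≤ √(C₂) T^{1−κ/2}, where [·]_+ is the componentwise positive part, x̌*_T is a static optimal sequence, C₁ = C_{1,1}/κ + C_{1,2}/(1−κ) + 2n·d(X)·K, C₂ = C_{2,1}(2nF + C₁), C_{2,1} = 2n(2G²/((1−κ)σ̲) + 1/(1−κ) + 2), C_{1,1} = 3n²τB₁F/(1−λ) + nB₁²/2, C_{1,2} = 4nG²/σ̲, τ = (1 − w/(2n²))^{−2}, λ = (1 − w/(2n²))^{1/ι}, and B₁ = 2F + G·d(X). -/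

import Mathlib

open scoped RealInnerProductSpace

noncomputable section

/-- Bregman divergence generated by `ψ` with gradient map `ψ'`. -/
def breg {d : ℕ} (ψ : EuclideanSpace ℝ (Fin d) → ℝ)
    (ψ' : EuclideanSpace ℝ (Fin d) → EuclideanSpace ℝ (Fin d))
    (x y : EuclideanSpace ℝ (Fin d)) : ℝ :=
  ψ x - ψ y - ⟪ψ' y, x - y⟫

/-- Componentwise positive part `[v]₊`. -/
def posPart {d : ℕ} (v : EuclideanSpace ℝ (Fin d)) : EuclideanSpace ℝ (Fin d) :=
  (WithLp.equiv 2 (Fin d → ℝ)).symm fun j => max (v j) 0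

/-- Build a Euclidean vector from a coordinate function. -/
def vecOf {d : ℕ} (v : Fin d → ℝ) : EuclideanSpace ℝ (Fin d) :=
  (WithLp.equiv 2 (Fin d → ℝ)).symm v

/-- Stack a family of per-agent vectors into the Euclidean product space. -/
def stack {n : ℕ} {p : Fin n → ℕ} (y : ∀ i, EuclideanSpace ℝ (Fin (p i))) :
    PiLp 2 (fun i => EuclideanSpace ℝ (Fin (p i))) :=
  (WithLp.equiv 2 (∀ i, EuclideanSpace ℝ (Fin (p i)))).symm y

/-- The setup and iterates of Algorithm 1 (distributed online primal-dual
dynamic mirror descent) of the paper. -/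
structure Alg (n m : ℕ) (p : Fin n → ℕ) where
  hn : 0 < n
  hm : 0 < m
  X : ∀ i : Fin n, Set (EuclideanSpace ℝ (Fin (p i)))
  hXconvex : ∀ i, Convex ℝ (X i)
  hXcompact : ∀ i, IsCompact (X i)
  hXnonempty : ∀ i, (X i).Nonempty
  dX : ℝ
  hdX : 0 < dX
  hdiam : ∀ u v : PiLp 2 (fun i => EuclideanSpace ℝ (Fin (p i))),
    (∀ i, u i ∈ X i) → (∀ i, v i ∈ X i) → ‖u - v‖ ≤ dX
  f : ℕ → ∀ i : Fin n, EuclideanSpace ℝ (Fin (p i)) → ℝ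
  r : ℕ → ∀ i : Fin n, EuclideanSpace ℝ (Fin (p i)) → ℝ
  g : ℕ → ∀ i : Fin n, EuclideanSpace ℝ (Fin (p i)) → EuclideanSpace ℝ (Fin m)
  hf0 : ∀ i z, f 0 i z = 0
  hr0 : ∀ i z, r 0 i z = 0
  hg0 : ∀ i z, g 0 i z = 0
  hfconvex : ∀ t i, ConvexOn ℝ (X i) (f t i)
  hrconvex : ∀ t i, ConvexOn ℝ (X i) (r t i)
  hgconvex : ∀ t i (j : Fin m), ConvexOn ℝ (X i) (fun z => g t i z j)
  F : ℝ
  hF : 0 < F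
  G : ℝ
  hG : 0 < G
  hfbound : ∀ t i, ∀ z ∈ X i, |f t i z| ≤ F
  hrbound : ∀ t i, ∀ z ∈ X i, |r t i z| ≤ F
  hgbound : ∀ t i, ∀ z ∈ X i, ‖g t i z‖ ≤ F
  Gf : ℕ → ∀ i : Fin n, EuclideanSpace ℝ (Fin (p i)) → EuclideanSpace ℝ (Fin (p i))
  Gr : ℕ → ∀ i : Fin n, EuclideanSpace ℝ (Fin (p i)) → EuclideanSpace ℝ (Fin (p i))
  Gg : ℕ → ∀ i : Fin n, EuclideanSpace ℝ (Fin (p i)) → Fin m → EuclideanSpace ℝ (Fin (p i))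
  hGfsub : ∀ t i, ∀ z ∈ X i, ∀ u ∈ X i, f t i z + ⟪Gf t i z, u - z⟫ ≤ f t i u
  hGrsub : ∀ t i, ∀ z ∈ X i, ∀ u ∈ X i, r t i z + ⟪Gr t i z, u - z⟫ ≤ r t i u
  hGgsub : ∀ t i, ∀ z ∈ X i, ∀ (j : Fin m), ∀ u ∈ X i,
    g t i z j + ⟪Gg t i z j, u - z⟫ ≤ g t i u j
  hGfbound : ∀ t i, ∀ z ∈ X i, ‖Gf t i z‖ ≤ G
  hGrbound : ∀ t i, ∀ z ∈ X i, ‖Gr t i z‖ ≤ G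
  hGgbound : ∀ t i, ∀ z ∈ X i, ∀ v, ‖vecOf (fun j => ⟪Gg t i z j, v⟫)‖ ≤ G * ‖v‖
  W : ℕ → Matrix (Fin n) (Fin n) ℝ
  hWnonneg : ∀ t i j, 0 ≤ W t i j
  hWrow : ∀ t i, ∑ j, W t i j = 1
  hWcol : ∀ t j, ∑ i, W t i j = 1
  w : ℝ
  hw0 : 0 < w
  hw1 : w < 1
  hWdiag : ∀ t i, w ≤ W t i i
  hWpos : ∀ t i j, 0 < W t i j → w ≤ W t i j
  iota : ℕ
  hiota : 0 < iota
  hconn : ∀ (t : ℕ) (c d : Fin n),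
    Relation.ReflTransGen (fun u v : Fin n => ∃ l < iota, 0 < W (t + l) v u) c d
  ψ : ∀ i : Fin n, EuclideanSpace ℝ (Fin (p i)) → ℝ
  ψ' : ∀ i : Fin n, EuclideanSpace ℝ (Fin (p i)) → EuclideanSpace ℝ (Fin (p i))
  hψgrad : ∀ i z, HasGradientAt (ψ i) (ψ' i z) z
  σ : Fin n → ℝ
  hσ : ∀ i, 0 < σ i
  hψstrong : ∀ i, ∀ z ∈ X i, ∀ u ∈ X i,
    ψ i u + ⟪ψ' i u, z - u⟫ + σ i / 2 * ‖z - u‖ ^ 2 ≤ ψ i z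
  K : ℝ
  hK : 0 < K
  hbregLip : ∀ i, ∀ z₁ ∈ X i, ∀ z₂ ∈ X i, ∀ u ∈ X i,
    |breg (ψ i) (ψ' i) z₁ u - breg (ψ i) (ψ' i) z₂ u| ≤ K * ‖z₁ - z₂‖
  Φ : ℕ → ∀ i : Fin n, EuclideanSpace ℝ (Fin (p i)) → EuclideanSpace ℝ (Fin (p i))
  hΦmaps : ∀ t i, ∀ z ∈ X i, Φ t i z ∈ X i
  hΦcontract : ∀ t i, ∀ z ∈ X i, ∀ u ∈ X i,
    breg (ψ i) (ψ' i) (Φ t i z) (Φ t i u) ≤ breg (ψ i) (ψ' i) z u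
  α : ℕ → ℝ
  β : ℕ → ℝ
  γ : ℕ → ℝ
  hαpos : ∀ t, 1 ≤ t → 0 < α t
  hβpos : ∀ t, 1 ≤ t → 0 < β t
  hγpos : ∀ t, 1 ≤ t → 0 < γ t
  hαanti : ∀ s t, 1 ≤ s → s ≤ t → α t ≤ α s
  hβanti : ∀ s t, 1 ≤ s → s ≤ t → β t ≤ β s
  hγanti : ∀ s t, 1 ≤ s → s ≤ t → γ t ≤ γ s
  x : ℕ → ∀ i : Fin n, EuclideanSpace ℝ (Fin (p i))
  xtil : ℕ → ∀ i : Fin n, EuclideanSpace ℝ (Fin (p i))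
  q : ℕ → Fin n → EuclideanSpace ℝ (Fin m)
  qtil : ℕ → Fin n → EuclideanSpace ℝ (Fin m)
  a : ℕ → ∀ i : Fin n, EuclideanSpace ℝ (Fin (p i))
  b : ℕ → Fin n → EuclideanSpace ℝ (Fin m)
  hx0 : ∀ i, x 0 i ∈ X i
  hq0 : ∀ i, q 0 i = 0
  hqtil : ∀ t, 1 ≤ t → ∀ i, qtil t i = ∑ j, W (t - 1) i j • q (t - 1) j
  ha : ∀ t, 1 ≤ t → ∀ i,
    a t i = Gf (t - 1) i (x (t - 1) i) + ∑ j, qtil t i j • Gg (t - 1) i (x (t - 1) i) j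
  hxtilmem : ∀ t, 1 ≤ t → ∀ i, xtil t i ∈ X i
  hxtilmin : ∀ t, 1 ≤ t → ∀ i, ∀ z ∈ X i,
    α t * ⟪xtil t i, a t i⟫ + α t * r (t - 1) i (xtil t i)
        + breg (ψ i) (ψ' i) (xtil t i) (x (t - 1) i)
      ≤ α t * ⟪z, a t i⟫ + α t * r (t - 1) i z + breg (ψ i) (ψ' i) z (x (t - 1) i)
  hb : ∀ t, 1 ≤ t → ∀ i,
    b t i = vecOf (fun j => ⟪Gg (t - 1) i (x (t - 1) i) j, xtil t i - x (t - 1) i⟫)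
      + g (t - 1) i (x (t - 1) i)
  hq : ∀ t, 1 ≤ t → ∀ i,
    q t i = posPart (qtil t i + γ t • (b t i - β t • qtil t i))
  hx : ∀ t, 1 ≤ t → ∀ i, x t i = Φ t i (xtil t i)

namespace Alg

variable {n m : ℕ} {p : Fin n → ℕ}

/-- Average dual variable `q̄_t`. -/
def qbar (S : Alg n m p) (t : ℕ) : EuclideanSpace ℝ (Fin m) :=
  (n : ℝ)⁻¹ • ∑ i, S.q t i

/-- `σ̲ = min_i σ_i`. -/
def sigmin (S : Alg n m p) : ℝ :=
  Finset.univ.inf' (Finset.univ_nonempty_iff.mpr ⟨⟨0, S.hn⟩⟩) S.σ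

/-- `τ = (1 − w/(2n²))⁻²`. -/
def tau (S : Alg n m p) : ℝ := ((1 - S.w / (2 * (n : ℝ) ^ 2)) ^ 2)⁻¹

/-- `λ = (1 − w/(2n²))^{1/ι}`. -/
def lam (S : Alg n m p) : ℝ := (1 - S.w / (2 * (n : ℝ) ^ 2)) ^ ((S.iota : ℝ))⁻¹

/-- `B₁ = 2F + G d(X)`. -/
def B1 (S : Alg n m p) : ℝ := 2 * S.F + S.G * S.dX

/-- `E₁(t) = n²τB₁F Σ_{s=1}^{t−1} γ_{s+1} λ^{t−1−s}`. -/
def E1 (S : Alg n m p) (t : ℕ) : ℝ :=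
  (n : ℝ) ^ 2 * S.tau * S.B1 * S.F *
    ∑ s ∈ Finset.Icc 1 (t - 1), S.γ (s + 1) * S.lam ^ (t - 1 - s)

/-- Global objective `f_t(y) = Σ_i (f_{i,t}(y_i) + r_{i,t}(y_i))`. -/
def fsum (S : Alg n m p) (t : ℕ) (y : ∀ i, EuclideanSpace ℝ (Fin (p i))) : ℝ :=
  ∑ i, (S.f t i (y i) + S.r t i (y i))

/-- Global constraint `g_t(y) = Σ_i g_{i,t}(y_i)`. -/
def gsum (S : Alg n m p) (t : ℕ) (y : ∀ i, EuclideanSpace ℝ (Fin (p i))) :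
    EuclideanSpace ℝ (Fin m) :=
  ∑ i, S.g t i (y i)

/-- Regret against a comparator sequence. -/
def reg (S : Alg n m p) (T : ℕ) (y : ℕ → ∀ i, EuclideanSpace ℝ (Fin (p i))) : ℝ :=
  ∑ t ∈ Finset.Icc 1 T, S.fsum t (S.x t) - ∑ t ∈ Finset.Icc 1 T, S.fsum t (y t)

/-- Feasibility of a comparator sequence on `1..T`. -/
def Feasible (S : Alg n m p) (T : ℕ) (y : ℕ → ∀ i, EuclideanSpace ℝ (Fin (p i))) : Prop :=
  ∀ t ∈ Finset.Icc 1 T, (∀ i, y t i ∈ S.X i) ∧ ∀ j, S.gsum t (y t) j ≤ 0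

/-- Accumulated dynamic variation `V_Φ(y_T)`. -/
def VPhi (S : Alg n m p) (T : ℕ) (y : ℕ → ∀ i, EuclideanSpace ℝ (Fin (p i))) : ℝ :=
  ∑ t ∈ Finset.Icc 1 (T - 1), ∑ i, ‖y (t + 1) i - S.Φ (t + 1) i (y t i)‖

/-- `E₂(t)` for a comparator sequence. -/
def E2 (S : Alg n m p) (y : ℕ → ∀ i, EuclideanSpace ℝ (Fin (p i))) (t : ℕ) : ℝ :=
  (S.α t)⁻¹ * ∑ i, (breg (S.ψ i) (S.ψ' i) (y (t - 1) i) (S.x (t - 1) i)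
    - breg (S.ψ i) (S.ψ' i) (y t i) (S.x t i))

/-- `C_{1,1} = 3n²τB₁F/(1−λ) + nB₁²/2`. -/
def C11 (S : Alg n m p) : ℝ :=
  3 * (n : ℝ) ^ 2 * S.tau * S.B1 * S.F / (1 - S.lam) + (n : ℝ) * S.B1 ^ 2 / 2

/-- `C_{1,2} = 4nG²/σ̲`. -/
def C12 (S : Alg n m p) : ℝ := 4 * (n : ℝ) * S.G ^ 2 / S.sigmin

/-- Constraint violation `‖[Σ_{t=1}^T g_t(x_t)]₊‖`. -/
def violation (S : Alg n m p) (T : ℕ) : ℝ :=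
  ‖posPart (∑ t ∈ Finset.Icc 1 T, S.gsum t (S.x t))‖

end Alg

/-- One averaging step: agent `i` forms the `W`-weighted combination of the family `x`. -/
def mix {n : ℕ} {M : Type*} [AddCommMonoid M] [Module ℝ M] (W : Matrix (Fin n) (Fin n) ℝ)
    (x : Fin n → M) : Fin n → M :=
  fun i => ∑ j, W i j • x j

/-- Repeated averaging with the weights `W 0, W 1, …`. -/
def evolve {n : ℕ} {M : Type*} [AddCommMonoid M] [Module ℝ M]
    (W : ℕ → Matrix (Fin n) (Fin n) ℝ) (x : Fin n → M) : ℕ → Fin n → M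
  | 0 => x
  | k + 1 => mix (W k) (evolve W x k)

/-- Squared dispersion of a real family around its mean. -/
def disp {n : ℕ} (x : Fin n → ℝ) : ℝ := ∑ i, (x i - (∑ j, x j) / n) ^ 2

section Averaging

variable {n : ℕ}

lemma sum_mix {M : Type*} [AddCommMonoid M] [Module ℝ M] {W : Matrix (Fin n) (Fin n) ℝ}
    (hcol : ∀ j, ∑ i, W i j = 1) (x : Fin n → M) : ∑ i, mix W x i = ∑ j, x j := by
  simp only [mix]
  rw [Finset.sum_comm]
  simp [← Finset.sum_smul, hcol]

lemma disp_nonneg (x : Fin n → ℝ) : 0 ≤ disp x :=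
  Finset.sum_nonneg fun _ _ => sq_nonneg _

lemma sum_sub_sq (x : Fin n → ℝ) (c : ℝ) :
    ∑ i, (x i - c) ^ 2 = ∑ i, x i ^ 2 - 2 * c * ∑ i, x i + n * c ^ 2 := by
  simp only [sub_sq, Finset.sum_add_distrib, Finset.sum_sub_distrib, Finset.sum_const,
    Finset.card_univ, Fintype.card_fin, nsmul_eq_mul, ← Finset.sum_mul, ← Finset.mul_sum]
  ring

lemma disp_eq (hn : 0 < n) (x : Fin n → ℝ) :
    disp x = ∑ i, x i ^ 2 - (∑ i, x i) ^ 2 / n := by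
  have hn' : (n : ℝ) ≠ 0 := by positivity
  rw [disp, sum_sub_sq]
  field_simp
  ring

lemma disp_le_sum_sub_sq (hn : 0 < n) (x : Fin n → ℝ) (c : ℝ) :
    disp x ≤ ∑ i, (x i - c) ^ 2 := by
  have hn' : (0 : ℝ) < n := by positivity
  have h : ∑ i, (x i - c) ^ 2 - disp x = (∑ i, x i - n * c) ^ 2 / n := by
    rw [disp_eq hn, sum_sub_sq]
    field_simp
    ring
  have : 0 ≤ (∑ i, x i - n * c) ^ 2 / n := by positivity
  linarith

lemma disp_le_of_forall_mem_Icc (hn : 0 < n) {x : Fin n → ℝ} {a b : ℝ}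
    (h : ∀ i, x i ∈ Set.Icc a b) : disp x ≤ n * (b - a) ^ 2 / 4 := by
  refine (disp_le_sum_sub_sq hn x ((a + b) / 2)).trans ?_
  calc ∑ i, (x i - (a + b) / 2) ^ 2 ≤ ∑ _i : Fin n, (b - a) ^ 2 / 4 := by
        refine Finset.sum_le_sum fun i _ => ?_
        nlinarith [mul_nonneg (sub_nonneg.2 (h i).1) (sub_nonneg.2 (h i).2)]
    _ = n * (b - a) ^ 2 / 4 := by simp; ring

lemma disp_mix_add (hn : 0 < n) {W : Matrix (Fin n) (Fin n) ℝ} (hrow : ∀ i, ∑ j, W i j = 1)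
    (hcol : ∀ j, ∑ i, W i j = 1) (x : Fin n → ℝ) :
    disp (mix W x) + ∑ i, ∑ j, W i j * (x j - mix W x i) ^ 2 = disp x := by
  have hi : ∀ i, ∑ j, W i j * (x j - mix W x i) ^ 2
      = ∑ j, W i j * x j ^ 2 - mix W x i ^ 2 := by
    intro i
    have h1 : ∑ j, W i j * (x j - mix W x i) ^ 2 = ∑ j, W i j * x j ^ 2
        - 2 * mix W x i * ∑ j, W i j * x j + (∑ j, W i j) * mix W x i ^ 2 := by
      rw [Finset.mul_sum, Finset.sum_mul, ← Finset.sum_sub_distrib, ← Finset.sum_add_distrib]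
      exact Finset.sum_congr rfl fun j _ => by ring
    have h2 : ∑ j, W i j * x j = mix W x i := by simp [mix]
    rw [h1, h2, hrow]
    ring
  have hs : ∑ i, ∑ j, W i j * x j ^ 2 = ∑ j, x j ^ 2 := by
    rw [Finset.sum_comm]
    simp [← Finset.sum_mul, hcol]
  rw [disp_eq hn, disp_eq hn, sum_mix hcol, Finset.sum_congr rfl fun i _ => hi i,
    Finset.sum_sub_distrib, hs]
  ring

lemma disp_mix_le (hn : 0 < n) {W : Matrix (Fin n) (Fin n) ℝ} (hnonneg : ∀ i j, 0 ≤ W i j)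
    (hrow : ∀ i, ∑ j, W i j = 1) (hcol : ∀ j, ∑ i, W i j = 1) (x : Fin n → ℝ) :
    disp (mix W x) ≤ disp x := by
  rw [← disp_mix_add hn hrow hcol x]
  have : 0 ≤ ∑ i, ∑ j, W i j * (x j - mix W x i) ^ 2 :=
    Finset.sum_nonneg fun i _ => Finset.sum_nonneg fun j _ =>
      mul_nonneg (hnonneg i j) (sq_nonneg _)
  linarith

lemma disp_mix_le_sub (hn : 0 < n) {W : Matrix (Fin n) (Fin n) ℝ} (hnonneg : ∀ i j, 0 ≤ W i j)
    (hrow : ∀ i, ∑ j, W i j = 1) (hcol : ∀ j, ∑ i, W i j = 1) (x : Fin n → ℝ)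
    {w : ℝ} (hw : 0 ≤ w) {i j : Fin n} (hij : i ≠ j) (hi : w ≤ W i i) (hj : w ≤ W i j) :
    disp (mix W x) ≤ disp x - w / 2 * (x i - x j) ^ 2 := by
  rw [← disp_mix_add hn hrow hcol x]
  set y := mix W x
  have hpos : ∀ k l, 0 ≤ W k l * (x l - y k) ^ 2 := fun k l =>
    mul_nonneg (hnonneg k l) (sq_nonneg _)
  have h1 : ∑ l, W i l * (x l - y i) ^ 2 ≤ ∑ k, ∑ l, W k l * (x l - y k) ^ 2 :=
    Finset.single_le_sum (f := fun k => ∑ l, W k l * (x l - y k) ^ 2)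
      (fun k _ => Finset.sum_nonneg fun l _ => hpos k l) (Finset.mem_univ i)
  have h2 : W i i * (x i - y i) ^ 2 + W i j * (x j - y i) ^ 2
      ≤ ∑ l, W i l * (x l - y i) ^ 2 := by
    rw [← Finset.sum_pair (f := fun l => W i l * (x l - y i) ^ 2) hij]
    exact Finset.sum_le_sum_of_subset_of_nonneg (Finset.subset_univ _) fun l _ _ => hpos i l
  have h3 := mul_le_mul_of_nonneg_right hi (sq_nonneg (x i - y i))
  have h4 := mul_le_mul_of_nonneg_right hj (sq_nonneg (x j - y i))
  have h5 : 0 ≤ w * (x i + x j - 2 * y i) ^ 2 := by positivity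
  nlinarith

/-- Among `n` reals spread over a distance `R`, some two neighbours are at least `R / n` apart. -/
lemma exists_gap (x : Fin n → ℝ) {i₀ j₀ : Fin n} (h : x i₀ < x j₀) :
    ∃ a b : ℝ, x j₀ - x i₀ ≤ n * (b - a) ∧ (∀ i, x i ≤ a ∨ b ≤ x i) ∧
      (∃ i, x i ≤ a) ∧ ∃ i, b ≤ x i := by
  have hn : 0 < n := i₀.pos
  have hn' : (0 : ℝ) < n := by positivity
  set e := Tuple.sort x
  set y := x ∘ e with hy
  have hmono : Monotone y := Tuple.monotone_sort x
  have hxy : ∀ i, x i = y (e.symm i) := by simp [hy]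
  obtain ⟨k, hk, hgap⟩ : ∃ k, ∃ hk : k + 1 < n,
      x j₀ - x i₀ ≤ n * (y ⟨k + 1, hk⟩ - y ⟨k, by omega⟩) := by
    by_contra! hcon
    have hle : ∀ k, ∀ hk : k < n, n * (y ⟨k, hk⟩ - y ⟨0, hn⟩) ≤ k * (x j₀ - x i₀) := by
      intro k
      induction k with
      | zero => intro hk; simp
      | succ k ih =>
        intro hk
        have h1 := ih (by omega)
        have h2 := hcon k hk
        push_cast
        linarith
    have h1 := hle (e.symm j₀) (e.symm j₀).2
    have h2 : y ⟨0, hn⟩ ≤ x i₀ := by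
      rw [hxy]
      exact hmono (Fin.mk_le_of_le_val (Nat.zero_le _))
    have h3 : ((e.symm j₀ : ℕ) : ℝ) + 1 ≤ n := by exact_mod_cast (e.symm j₀).2
    simp only [Fin.eta, ← hxy] at h1
    nlinarith
  refine ⟨y ⟨k, by omega⟩, y ⟨k + 1, hk⟩, hgap, fun i => ?_, ⟨e ⟨k, by omega⟩, le_rfl⟩,
    ⟨e ⟨k + 1, hk⟩, le_rfl⟩⟩
  rw [hxy i]
  rcases Nat.lt_or_ge k (e.symm i) with hlt | hge
  · exact Or.inr (hmono hlt)
  · exact Or.inl (hmono hge)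

variable {W : ℕ → Matrix (Fin n) (Fin n) ℝ}

lemma disp_evolve_antitone (hn : 0 < n) (hnonneg : ∀ k i j, 0 ≤ W k i j)
    (hrow : ∀ k i, ∑ j, W k i j = 1) (hcol : ∀ k j, ∑ i, W k i j = 1) (x : Fin n → ℝ) :
    Antitone fun k => disp (evolve W x k) :=
  antitone_nat_of_succ_le fun k => disp_mix_le hn (hnonneg k) (hrow k) (hcol k) _

/-- As long as the weights do not couple `A` with its complement, the averages on `A` obey every
upper bound of the initial values on `A`. -/
lemma evolve_le_of_forall_not_pos (hnonneg : ∀ k i j, 0 ≤ W k i j)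
    (hrow : ∀ k i, ∑ j, W k i j = 1) {x : Fin n → ℝ} {A : Set (Fin n)} {a : ℝ}
    (hx : ∀ i ∈ A, x i ≤ a) {k : ℕ} (hk : ∀ l < k, ∀ i ∈ A, ∀ j ∉ A, ¬ 0 < W l i j) :
    ∀ i ∈ A, evolve W x k i ≤ a := by
  induction k with
  | zero => exact hx
  | succ k ih =>
    intro i hi
    have ih' := ih fun l hl => hk l (by omega)
    calc evolve W x (k + 1) i = ∑ j, W k i j * evolve W x k j := rfl
      _ ≤ ∑ j, W k i j * a := by
        refine Finset.sum_le_sum fun j _ => ?_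
        by_cases hj : j ∈ A
        · exact mul_le_mul_of_nonneg_left (ih' j hj) (hnonneg k i j)
        · have : W k i j = 0 := le_antisymm (not_lt.1 (hk k (by omega) i hi j hj)) (hnonneg k i j)
          simp [this]
      _ = a := by rw [← Finset.sum_mul, hrow, one_mul]

lemma le_evolve_of_forall_not_pos (hnonneg : ∀ k i j, 0 ≤ W k i j)
    (hrow : ∀ k i, ∑ j, W k i j = 1) {x : Fin n → ℝ} {A : Set (Fin n)} {a : ℝ}
    (hx : ∀ i ∈ A, a ≤ x i) {k : ℕ} (hk : ∀ l < k, ∀ i ∈ A, ∀ j ∉ A, ¬ 0 < W l i j) :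
    ∀ i ∈ A, a ≤ evolve W x k i := by
  induction k with
  | zero => exact hx
  | succ k ih =>
    intro i hi
    have ih' := ih fun l hl => hk l (by omega)
    calc a = ∑ j, W k i j * a := by rw [← Finset.sum_mul, hrow, one_mul]
      _ ≤ ∑ j, W k i j * evolve W x k j := by
        refine Finset.sum_le_sum fun j _ => ?_
        by_cases hj : j ∈ A
        · exact mul_le_mul_of_nonneg_left (ih' j hj) (hnonneg k i j)
        · have : W k i j = 0 := le_antisymm (not_lt.1 (hk k (by omega) i hi j hj)) (hnonneg k i j)
          simp [this]
      _ = evolve W x (k + 1) i := rfl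

/-- If every vertex is reachable from every other one, each nontrivial cut is crossed. -/
lemma exists_crossing {V : Type*} {r : V → V → Prop} (hconn : ∀ c d, Relation.ReflTransGen r c d)
    {A : Set V} {c d : V} (hc : c ∈ A) (hd : d ∉ A) : ∃ u ∈ A, ∃ v ∉ A, r u v := by
  by_contra! hcon
  have : ∀ v, Relation.ReflTransGen r c v → v ∈ A := by
    intro v hv
    induction hv with
    | refl => exact hc
    | tail _ huv ih => exact by_contra fun hv => hcon _ ih _ hv huv
  exact hd (this d (hconn c d))

lemma disp_evolve_le (hn : 0 < n) (hnonneg : ∀ k i j, 0 ≤ W k i j)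
    (hrow : ∀ k i, ∑ j, W k i j = 1) (hcol : ∀ k j, ∑ i, W k i j = 1)
    {w : ℝ} (hw : 0 ≤ w) (hdiag : ∀ k i, w ≤ W k i i) (hpos : ∀ k i j, 0 < W k i j → w ≤ W k i j)
    {N : ℕ} (hconn : ∀ c d : Fin n,
      Relation.ReflTransGen (fun u v : Fin n => ∃ l < N, 0 < W l v u) c d) (x : Fin n → ℝ) :
    disp (evolve W x N) ≤ (1 - 2 * w / (n : ℝ) ^ 3) * disp x := by
  have hn' : (0 : ℝ) < n := by positivity
  have : Nonempty (Fin n) := ⟨⟨0, hn⟩⟩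
  have hanti := disp_evolve_antitone hn hnonneg hrow hcol x
  obtain ⟨i₀, hi₀⟩ := Finite.exists_min x
  obtain ⟨j₀, hj₀⟩ := Finite.exists_max x
  have hdisp := disp_le_of_forall_mem_Icc hn fun i => ⟨hi₀ i, hj₀ i⟩
  rcases (hi₀ j₀).eq_or_lt with heq | hlt
  · have h0 : disp x = 0 := le_antisymm (by simpa [heq] using hdisp) (disp_nonneg x)
    have h1 : disp (evolve W x N) ≤ disp x := hanti (Nat.zero_le N)
    simpa [h0] using h1
  obtain ⟨a, b, hab, hcut, ⟨c, hc⟩, ⟨d, hd⟩⟩ := exists_gap x hlt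
  have hab' : 0 < b - a := by
    by_contra! hcon
    nlinarith
  set A : Set (Fin n) := {i | x i ≤ a}
  have hAc : ∀ i ∉ A, b ≤ x i := fun i hi => (hcut i).resolve_left hi
  have hdA : d ∉ A := fun h => by
    have : x d ≤ a := h
    linarith
  classical
  have hex : ∃ l, ∃ u v, (u ∈ A ↔ v ∉ A) ∧ 0 < W l v u := by
    obtain ⟨u, hu, v, hv, l, -, hl⟩ := exists_crossing hconn (show c ∈ A from hc) hdA
    exact ⟨l, u, v, by simp [hu, hv], hl⟩
  have hfind : Nat.find hex < N := by
    obtain ⟨u, hu, v, hv, l, hlN, hl⟩ := exists_crossing hconn (show c ∈ A from hc) hdA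
    exact (Nat.find_min' hex ⟨u, v, by simp [hu, hv], hl⟩).trans_lt hlN
  obtain ⟨u, v, huv, hWuv⟩ := Nat.find_spec hex
  have hmin : ∀ l < Nat.find hex, ∀ u v, (u ∈ A ↔ v ∉ A) → ¬ 0 < W l v u :=
    fun l hl u v h h' => Nat.find_min hex hl ⟨u, v, h, h'⟩
  set k := Nat.find hex
  have hlow : ∀ i ∈ A, evolve W x k i ≤ a :=
    evolve_le_of_forall_not_pos hnonneg hrow (fun i hi => hi)
      fun l hl i hi j hj => hmin l hl j i ⟨fun h => (hj h).elim, fun h => (h hi).elim⟩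
  have hhigh : ∀ i ∈ Aᶜ, b ≤ evolve W x k i :=
    le_evolve_of_forall_not_pos hnonneg hrow hAc
      fun l hl i hi j hj => hmin l hl j i ⟨fun _ => hi, fun _ => not_not.1 hj⟩
  have hne : v ≠ u := by
    rintro rfl
    tauto
  have hsq : (b - a) ^ 2 ≤ (evolve W x k v - evolve W x k u) ^ 2 := by
    by_cases hu : u ∈ A
    · have h1 := hlow u hu
      have h2 := hhigh v (huv.1 hu)
      nlinarith
    · have h1 := hhigh u hu
      have h2 := hlow v (by tauto)
      nlinarith
  have hdrop := disp_mix_le_sub hn (hnonneg k) (hrow k) (hcol k) (evolve W x k) hw hne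
    (hdiag k v) (hpos k v u hWuv)
  have h1 : disp (evolve W x N) ≤ disp (mix (W k) (evolve W x k)) := hanti hfind
  have h2 : disp (evolve W x k) ≤ disp x := hanti (Nat.zero_le k)
  have h3 : disp x ≤ (n : ℝ) ^ 3 * (b - a) ^ 2 / 4 := by
    have : (x j₀ - x i₀) ^ 2 ≤ (n * (b - a)) ^ 2 :=
      pow_le_pow_left₀ (by linarith) hab 2
    nlinarith
  have h4 : 2 * w / (n : ℝ) ^ 3 * disp x ≤ w / 2 * (b - a) ^ 2 :=
    calc 2 * w / (n : ℝ) ^ 3 * disp x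
        ≤ 2 * w / (n : ℝ) ^ 3 * ((n : ℝ) ^ 3 * (b - a) ^ 2 / 4) := by gcongr
      _ = w / 2 * (b - a) ^ 2 := by field_simp; ring
  nlinarith [mul_le_mul_of_nonneg_left hsq (div_nonneg hw zero_le_two)]

end Averaging

section Disagreement

variable {n m : ℕ}

/-- Deviations of a family of vectors from its mean, as an element of the product Hilbert space. -/
def centered (x : Fin n → EuclideanSpace ℝ (Fin m)) :
    PiLp 2 (fun _ : Fin n => EuclideanSpace ℝ (Fin m)) :=
  WithLp.toLp 2 fun i => x i - (n : ℝ)⁻¹ • ∑ j, x j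

@[simp]
lemma centered_apply (x : Fin n → EuclideanSpace ℝ (Fin m)) (i : Fin n) :
    centered x i = x i - (n : ℝ)⁻¹ • ∑ j, x j := rfl

lemma centered_add (x y : Fin n → EuclideanSpace ℝ (Fin m)) :
    centered (x + y) = centered x + centered y := by
  ext i : 1
  simp only [centered_apply, PiLp.add_apply, Pi.add_apply, Finset.sum_add_distrib, smul_add]
  abel

@[simp]
lemma centered_zero : centered (0 : Fin n → EuclideanSpace ℝ (Fin m)) = 0 := by
  ext i : 1
  simp

lemma norm_sq_centered (x : Fin n → EuclideanSpace ℝ (Fin m)) :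
    ‖centered x‖ ^ 2 = ∑ k, disp fun i => x i k := by
  rw [PiLp.norm_sq_eq_of_L2]
  simp only [EuclideanSpace.norm_sq_eq, disp]
  rw [Finset.sum_comm]
  refine Finset.sum_congr rfl fun k _ => Finset.sum_congr rfl fun i _ => ?_
  simp [div_eq_inv_mul]

lemma mix_apply (W : Matrix (Fin n) (Fin n) ℝ) (x : Fin n → EuclideanSpace ℝ (Fin m))
    (i : Fin n) (k : Fin m) : mix W x i k = mix W (fun j => x j k) i := by
  simp [mix]

lemma evolve_apply (W : ℕ → Matrix (Fin n) (Fin n) ℝ) (x : Fin n → EuclideanSpace ℝ (Fin m))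
    (t : ℕ) (i : Fin n) (k : Fin m) : evolve W x t i k = evolve W (fun j => x j k) t i := by
  induction t generalizing i with
  | zero => rfl
  | succ t ih => simp only [evolve, mix_apply, ih]

lemma mix_sub (W : Matrix (Fin n) (Fin n) ℝ) (x y : Fin n → EuclideanSpace ℝ (Fin m)) :
    mix W (x - y) = mix W x - mix W y := by
  ext1 i
  simp [mix, smul_sub]

lemma norm_centered_mix_le (hn : 0 < n) {W : Matrix (Fin n) (Fin n) ℝ}
    (hnonneg : ∀ i j, 0 ≤ W i j) (hrow : ∀ i, ∑ j, W i j = 1) (hcol : ∀ j, ∑ i, W i j = 1)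
    (x : Fin n → EuclideanSpace ℝ (Fin m)) : ‖centered (mix W x)‖ ≤ ‖centered x‖ := by
  refine le_of_pow_le_pow_left₀ two_ne_zero (norm_nonneg _) ?_
  rw [norm_sq_centered, norm_sq_centered]
  refine Finset.sum_le_sum fun k _ => ?_
  simp only [mix_apply]
  exact disp_mix_le hn hnonneg hrow hcol _

lemma norm_centered_evolve_le (hn : 0 < n) {W : ℕ → Matrix (Fin n) (Fin n) ℝ}
    (hnonneg : ∀ k i j, 0 ≤ W k i j)
    (hrow : ∀ k i, ∑ j, W k i j = 1) (hcol : ∀ k j, ∑ i, W k i j = 1)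
    {w : ℝ} (hw : 0 ≤ w) (hw1 : w ≤ 1) (hdiag : ∀ k i, w ≤ W k i i)
    (hpos : ∀ k i j, 0 < W k i j → w ≤ W k i j) {N : ℕ} (hconn : ∀ c d : Fin n,
      Relation.ReflTransGen (fun u v : Fin n => ∃ l < N, 0 < W l v u) c d)
    (x : Fin n → EuclideanSpace ℝ (Fin m)) :
    ‖centered (evolve W x N)‖ ≤ (1 - w / (n : ℝ) ^ 3) * ‖centered x‖ := by
  have hn1 : (1 : ℝ) ≤ (n : ℝ) ^ 3 := one_le_pow₀ (by exact_mod_cast hn)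
  have hρ : 0 ≤ 1 - w / (n : ℝ) ^ 3 := by
    rw [sub_nonneg, div_le_one (by positivity)]
    linarith
  refine le_of_pow_le_pow_left₀ two_ne_zero (mul_nonneg hρ (norm_nonneg _)) ?_
  have h1 : ‖centered (evolve W x N)‖ ^ 2 ≤ (1 - 2 * w / (n : ℝ) ^ 3) * ‖centered x‖ ^ 2 := by
    rw [norm_sq_centered, norm_sq_centered, Finset.mul_sum]
    refine Finset.sum_le_sum fun k _ => ?_
    simp only [evolve_apply]
    exact disp_evolve_le hn hnonneg hrow hcol hw hdiag hpos hconn _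
  rw [mul_pow]
  refine h1.trans (mul_le_mul_of_nonneg_right ?_ (sq_nonneg _))
  have h2 : 2 * w / (n : ℝ) ^ 3 = 2 * (w / (n : ℝ) ^ 3) := by ring
  rw [h2]
  nlinarith [sq_nonneg (w / (n : ℝ) ^ 3)]

lemma norm_centered_le (hn : 0 < n) {x : Fin n → EuclideanSpace ℝ (Fin m)} {e : ℝ}
    (he : 0 ≤ e) (hx : ∀ i, ‖x i‖ ≤ e) : ‖centered x‖ ≤ √n * e := by
  refine le_of_pow_le_pow_left₀ two_ne_zero (by positivity) ?_
  calc ‖centered x‖ ^ 2 ≤ ∑ k, ∑ i, (x i k) ^ 2 := by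
        rw [norm_sq_centered]
        exact Finset.sum_le_sum fun k _ => by
          simpa using disp_le_sum_sub_sq hn (fun i => x i k) 0
    _ = ∑ i, ‖x i‖ ^ 2 := by
        rw [Finset.sum_comm]
        simp [EuclideanSpace.norm_sq_eq]
    _ ≤ ∑ _i : Fin n, e ^ 2 := Finset.sum_le_sum fun i _ =>
        pow_le_pow_left₀ (norm_nonneg _) (hx i) 2
    _ = (√n * e) ^ 2 := by simp [mul_pow]

lemma sum_norm_sub_mean_le (x : Fin n → EuclideanSpace ℝ (Fin m)) :
    ∑ i, ‖x i - (n : ℝ)⁻¹ • ∑ j, x j‖ ≤ √n * ‖centered x‖ := by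
  refine le_of_pow_le_pow_left₀ two_ne_zero (by positivity) ?_
  have h := sq_sum_le_card_mul_sum_sq (s := Finset.univ)
    (f := fun i => ‖x i - (n : ℝ)⁻¹ • ∑ j, x j‖)
  rw [mul_pow, PiLp.norm_sq_eq_of_L2]
  simpa using h

lemma sum_range_shift_le {u : ℕ → ℝ} (hu : ∀ k, 0 ≤ u k) (c : ℕ) {M N : ℕ} (hM : M ≤ N + c) :
    ∑ t ∈ Finset.range M, (if c ≤ t then u (t - c) else 0) ≤ ∑ s ∈ Finset.range N, u s := by
  have h0 : ∀ t ∈ Finset.range c, (if c ≤ t then u (t - c) else 0) = 0 := fun t ht =>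
    if_neg (by simpa using ht)
  calc ∑ t ∈ Finset.range M, (if c ≤ t then u (t - c) else 0)
      ≤ ∑ t ∈ Finset.range (c + N), (if c ≤ t then u (t - c) else 0) :=
        Finset.sum_le_sum_of_subset_of_nonneg
          (Finset.range_subset_range.2 (by omega)) fun t _ _ => by
            split_ifs
            exacts [hu _, le_rfl]
    _ = ∑ s ∈ Finset.range N, u s := by
        rw [Finset.sum_range_add, Finset.sum_eq_zero h0]
        simp

/-- A nonnegative sequence that contracts by `ρ` over blocks of length `N`, up to perturbations
`e`, is summable against the perturbations. -/
lemma sum_le_of_block_contraction {d e : ℕ → ℝ} {ρ : ℝ} {N : ℕ} (hρ : 0 ≤ ρ)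
    (hd : ∀ t, 0 ≤ d t) (he : ∀ t, 0 ≤ e t) (hinit : ∀ t, d t ≤ ∑ k ∈ Finset.range t, e k)
    (hstep : ∀ t, d (t + N) ≤ ρ * d t + ∑ k ∈ Finset.range N, e (t + k)) (T : ℕ) :
    (1 - ρ) * ∑ t ∈ Finset.range (T + 1), d t ≤ N * ∑ t ∈ Finset.range T, e t := by
  have hle : ∀ t, d t ≤ ρ * (if N ≤ t then d (t - N) else 0) +
      ∑ j ∈ Finset.range N, (if j + 1 ≤ t then e (t - (j + 1)) else 0) := by
    intro t
    rcases le_or_gt N t with hN | hN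
    · obtain ⟨s, rfl⟩ := Nat.exists_eq_add_of_le' hN
      rw [if_pos hN, Nat.add_sub_cancel]
      refine (hstep s).trans_eq ?_
      rw [← Finset.sum_range_reflect (fun k => e (s + k))]
      congr 1
      refine Finset.sum_congr rfl fun j hj => ?_
      have := Finset.mem_range.1 hj
      rw [if_pos (by omega)]
      congr 1
      omega
    · rw [if_neg (by omega), mul_zero, zero_add]
      refine (hinit t).trans ?_
      rw [← Finset.sum_range_reflect]
      refine (Finset.sum_le_sum fun j hj => ?_).trans
        (Finset.sum_le_sum_of_subset_of_nonneg (Finset.range_subset_range.2 hN.le) fun j _ _ => ?_)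
      · have := Finset.mem_range.1 hj
        rw [if_pos (by omega), show t - 1 - j = t - (j + 1) by omega]
      · split_ifs
        exacts [he _, le_rfl]
  have hsum : ∑ t ∈ Finset.range (T + 1), d t ≤
      ρ * ∑ t ∈ Finset.range (T + 1), d t + N * ∑ t ∈ Finset.range T, e t := by
    refine (Finset.sum_le_sum fun t _ => hle t).trans ?_
    rw [Finset.sum_add_distrib, ← Finset.mul_sum, Finset.sum_comm]
    refine add_le_add
      (mul_le_mul_of_nonneg_left (sum_range_shift_le hd N (Nat.le_add_right _ _)) hρ) ?_
    · calc ∑ j ∈ Finset.range N, ∑ t ∈ Finset.range (T + 1),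
            (if j + 1 ≤ t then e (t - (j + 1)) else 0)
          ≤ ∑ _j ∈ Finset.range N, ∑ t ∈ Finset.range T, e t :=
            Finset.sum_le_sum fun j _ => sum_range_shift_le he (j + 1) (by omega)
        _ = N * ∑ t ∈ Finset.range T, e t := by simp
  linarith

/-- Accumulated disagreement of a perturbed averaging process started from consensus at `0`. -/
lemma sum_norm_centered_le (hn : 0 < n) {W : ℕ → Matrix (Fin n) (Fin n) ℝ}
    (hnonneg : ∀ k i j, 0 ≤ W k i j)
    (hrow : ∀ k i, ∑ j, W k i j = 1) (hcol : ∀ k j, ∑ i, W k i j = 1)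
    {w : ℝ} (hw : 0 < w) (hw1 : w ≤ 1) (hdiag : ∀ k i, w ≤ W k i i)
    (hpos : ∀ k i j, 0 < W k i j → w ≤ W k i j) {N : ℕ} (hconn : ∀ t, ∀ c d : Fin n,
      Relation.ReflTransGen (fun u v : Fin n => ∃ l < N, 0 < W (t + l) v u) c d)
    {q : ℕ → Fin n → EuclideanSpace ℝ (Fin m)} (hq0 : ∀ i, q 0 i = 0) {e : ℕ → ℝ}
    (hq : ∀ t i, ‖q (t + 1) i - mix (W t) (q t) i‖ ≤ e t) (T : ℕ) :
    ∑ t ∈ Finset.range (T + 1), ‖centered (q t)‖ ≤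
      N * (n : ℝ) ^ 3 / w * (√n * ∑ t ∈ Finset.range T, e t) := by
  have hn' : (0 : ℝ) < n := by positivity
  have hn1 : (1 : ℝ) ≤ (n : ℝ) ^ 3 := one_le_pow₀ (by exact_mod_cast hn)
  have he : ∀ t, 0 ≤ e t := fun t => (norm_nonneg _).trans (hq t ⟨0, hn⟩)
  have herr : ∀ s k, ‖centered (q (s + k) - evolve (fun l => W (s + l)) (q s) k)‖ ≤
      ∑ l ∈ Finset.range k, √n * e (s + l) := by
    intro s k
    induction k with
    | zero => simp [evolve]
    | succ k ih =>
      have hsplit : q (s + (k + 1)) - evolve (fun l => W (s + l)) (q s) (k + 1) =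
          mix (W (s + k)) (q (s + k) - evolve (fun l => W (s + l)) (q s) k) +
            (q (s + k + 1) - mix (W (s + k)) (q (s + k))) := by
        rw [mix_sub]
        simp only [evolve, ← add_assoc]
        abel
      rw [hsplit, centered_add, Finset.sum_range_succ]
      exact (norm_add_le _ _).trans (add_le_add
        ((norm_centered_mix_le hn (hnonneg _) (hrow _) (hcol _) _).trans ih)
        (norm_centered_le hn (he _) (hq _)))
  have hle : ∀ s k, ‖centered (q (s + k))‖ ≤ ‖centered (evolve (fun l => W (s + l)) (q s) k)‖ +
      ∑ l ∈ Finset.range k, √n * e (s + l) := by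
    intro s k
    have : q (s + k) = evolve (fun l => W (s + l)) (q s) k +
        (q (s + k) - evolve (fun l => W (s + l)) (q s) k) := by abel
    rw [this, centered_add]
    exact (norm_add_le _ _).trans (by gcongr; exact herr s k)
  have hzero : ∀ k, evolve (fun l => W (0 + l)) (q 0) k = 0 := by
    intro k
    induction k with
    | zero => exact funext hq0
    | succ k ih =>
      rw [evolve, ih]
      funext i
      simp [mix]
  have hkey := sum_le_of_block_contraction (ρ := 1 - w / (n : ℝ) ^ 3) (N := N)
    (d := fun t => ‖centered (q t)‖) (e := fun t => √n * e t)
    (by rw [sub_nonneg, div_le_one (by positivity)]; linarith) (fun _ => norm_nonneg _)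
    (fun t => mul_nonneg (Real.sqrt_nonneg _) (he t))
    (fun t => by
      have := hle 0 t
      rw [hzero] at this
      simpa only [centered_zero, norm_zero, zero_add] using this)
    (fun t => (hle t N).trans (by
      gcongr
      exact norm_centered_evolve_le hn (fun k => hnonneg _) (fun k => hrow _) (fun k => hcol _)
        hw.le hw1 (fun k => hdiag _) (fun k => hpos _) (hconn t) _)) T
  rw [← Finset.mul_sum, sub_sub_cancel] at hkey
  rw [div_mul_eq_mul_div, le_div_iff₀ hw]
  rw [div_mul_eq_mul_div, div_le_iff₀ (by positivity)] at hkey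
  linarith

end Disagreement

section PowerSums

lemma sum_inv_rpow_le {s : ℝ} (hs0 : 0 < s) (hs1 : s < 1) (T : ℕ) :
    ∑ t ∈ Finset.range T, (((t + 1 : ℕ) : ℝ) ^ s)⁻¹ ≤ (T : ℝ) ^ (1 - s) / (1 - s) := by
  have hs : 0 < 1 - s := by linarith
  rw [le_div_iff₀ hs]
  induction T with
  | zero => simp [hs.ne']
  | succ T ih =>
    rw [Finset.sum_range_succ, add_mul]
    have hT : (0 : ℝ) < ((T + 1 : ℕ) : ℝ) := by positivity
    have hsplit : (((T + 1 : ℕ) : ℝ) ^ s)⁻¹ =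
        ((T + 1 : ℕ) : ℝ) ^ (1 - s) * (((T + 1 : ℕ) : ℝ))⁻¹ := by
      rw [← Real.rpow_neg hT.le, Real.rpow_sub hT, Real.rpow_one, Real.rpow_neg hT.le]
      field_simp
    have hfac : (T : ℝ) = ((T + 1 : ℕ) : ℝ) * (1 + -(((T + 1 : ℕ) : ℝ))⁻¹) := by
      field_simp
      push_cast
      ring
    have hinv : (((T + 1 : ℕ) : ℝ))⁻¹ ≤ 1 := inv_le_one_of_one_le₀ (by
      push_cast
      linarith [T.cast_nonneg (α := ℝ)])
    have hbern := rpow_one_add_le_one_add_mul_self (s := -(((T + 1 : ℕ) : ℝ))⁻¹)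
      (by linarith) hs.le (by linarith : 1 - s ≤ 1)
    have hpow : (T : ℝ) ^ (1 - s) ≤
        ((T + 1 : ℕ) : ℝ) ^ (1 - s) * (1 + (1 - s) * -(((T + 1 : ℕ) : ℝ))⁻¹) := by
      conv_lhs => rw [hfac, Real.mul_rpow hT.le (by linarith)]
      gcongr
    rw [hsplit]
    linarith

end PowerSums

section Euclidean

variable {d : ℕ}

@[simp]
lemma posPart_apply (v : EuclideanSpace ℝ (Fin d)) (j : Fin d) : posPart v j = max (v j) 0 := rfl

@[simp]
lemma vecOf_apply (v : Fin d → ℝ) (j : Fin d) : vecOf v j = v j := rfl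

lemma inner_eq_sum (u v : EuclideanSpace ℝ (Fin d)) : ⟪u, v⟫ = ∑ j, u j * v j := by
  rw [PiLp.inner_apply]
  exact Finset.sum_congr rfl fun j _ => by simp [mul_comm]

lemma norm_le_norm_of_abs_le {u v : EuclideanSpace ℝ (Fin d)} (h : ∀ j, |u j| ≤ |v j|) :
    ‖u‖ ≤ ‖v‖ := by
  refine le_of_pow_le_pow_left₀ two_ne_zero (norm_nonneg _) ?_
  rw [EuclideanSpace.norm_sq_eq, EuclideanSpace.norm_sq_eq]
  exact Finset.sum_le_sum fun j _ => pow_le_pow_left₀ (norm_nonneg _) (h j) 2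

lemma norm_posPart_sub_le (u : EuclideanSpace ℝ (Fin d)) {v : EuclideanSpace ℝ (Fin d)}
    (hv : ∀ j, 0 ≤ v j) : ‖posPart u - v‖ ≤ ‖u - v‖ := by
  refine norm_le_norm_of_abs_le fun j => ?_
  simp only [PiLp.sub_apply, posPart_apply]
  rcases max_cases (u j) 0 with ⟨h, -⟩ | ⟨h, h'⟩
  · rw [h]
  · rw [h, abs_of_nonpos (by linarith [hv j]), abs_of_nonpos (by linarith [hv j])]
    linarith

lemma inner_posPart_self (v : EuclideanSpace ℝ (Fin d)) : ⟪posPart v, v⟫ = ‖posPart v‖ ^ 2 := by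
  rw [inner_eq_sum, EuclideanSpace.norm_sq_eq]
  refine Finset.sum_congr rfl fun j _ => ?_
  rw [Real.norm_eq_abs, sq_abs, posPart_apply]
  rcases max_cases (v j) 0 with ⟨h, -⟩ | ⟨h, -⟩ <;> rw [h] <;> ring

lemma inner_sub_grad_eq_breg (ψ : EuclideanSpace ℝ (Fin d) → ℝ)
    (ψ' : EuclideanSpace ℝ (Fin d) → EuclideanSpace ℝ (Fin d))
    (x y z : EuclideanSpace ℝ (Fin d)) :
    ⟪ψ' y, z - y⟫ - ⟪ψ' x, z - y⟫ = breg ψ ψ' z x - breg ψ ψ' z y - breg ψ ψ' y x := by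
  simp only [breg, inner_sub_right]
  ring

/-- Optimality of a composite mirror descent step. -/
lemma mirror_descent_step {X : Set (EuclideanSpace ℝ (Fin d))}
    {r : EuclideanSpace ℝ (Fin d) → ℝ} (hr : ConvexOn ℝ X r) {ψ : EuclideanSpace ℝ (Fin d) → ℝ}
    {ψ' : EuclideanSpace ℝ (Fin d) → EuclideanSpace ℝ (Fin d)}
    {a x y z : EuclideanSpace ℝ (Fin d)} (hψ : HasGradientAt ψ (ψ' y) y) {α : ℝ} (hα : 0 ≤ α)
    (hy : y ∈ X) (hz : z ∈ X)
    (hmin : ∀ u ∈ X, α * ⟪y, a⟫ + α * r y + breg ψ ψ' y x ≤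
      α * ⟪u, a⟫ + α * r u + breg ψ ψ' u x) :
    α * ⟪y - z, a⟫ + α * (r y - r z) ≤ breg ψ ψ' z x - breg ψ ψ' z y - breg ψ ψ' y x := by
  rw [← inner_sub_grad_eq_breg]
  have hline : Filter.Tendsto (fun s : ℝ => s⁻¹ • (ψ (y + s • (z - y)) - ψ y))
      (nhdsWithin 0 (Set.Ioi 0)) (nhds ⟪ψ' y, z - y⟫) := by
    have h := (hψ.hasFDerivAt.hasLineDerivAt (z - y)).tendsto_slope_zero_right
    simpa using h
  suffices h : α * ⟪y - z, a⟫ + α * (r y - r z) + ⟪ψ' x, z - y⟫ ≤ ⟪ψ' y, z - y⟫ by linarith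
  refine ge_of_tendsto hline ?_
  filter_upwards [Ioo_mem_nhdsGT (zero_lt_one (α := ℝ))] with s hs
  have hs0 : 0 < s := hs.1
  have hcomb : y + s • (z - y) = (1 - s) • y + s • z := by
    rw [smul_sub, sub_smul, one_smul]
    abel
  have hmem : y + s • (z - y) ∈ X := by
    rw [hcomb]
    exact hr.1 hy hz (by linarith [hs.2]) hs0.le (by ring)
  have hconv : r (y + s • (z - y)) ≤ (1 - s) * r y + s * r z := by
    rw [hcomb]
    simpa using hr.2 hy hz (by linarith [hs.2]) hs0.le (by ring)
  have h1 := hmin _ hmem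
  have h2 := mul_le_mul_of_nonneg_left hconv hα
  simp only [breg, inner_sub_right, inner_add_right, inner_add_left, inner_smul_left,
    inner_smul_right, inner_sub_left, RCLike.conj_to_real] at h1 ⊢
  rw [smul_eq_mul, inv_mul_eq_div, le_div_iff₀ hs0]
  linarith

end Euclidean

namespace Alg

variable {n m : ℕ} {p : Fin n → ℕ} (S : Alg n m p)

lemma x_mem (t : ℕ) (i : Fin n) : S.x t i ∈ S.X i := by
  rcases Nat.eq_zero_or_pos t with rfl | ht
  · exact S.hx0 i
  · rw [S.hx t ht]
    exact S.hΦmaps t i _ (S.hxtilmem t ht i)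

lemma qtil_succ (t : ℕ) (i : Fin n) : S.qtil (t + 1) i = mix (S.W t) (S.q t) i :=
  S.hqtil (t + 1) (by omega) i

lemma q_nonneg (t : ℕ) (i : Fin n) (j : Fin m) : 0 ≤ S.q t i j := by
  rcases Nat.eq_zero_or_pos t with rfl | ht
  · simp [S.hq0]
  · rw [S.hq t ht]
    exact le_max_right _ _

lemma qtil_nonneg (t : ℕ) (i : Fin n) (j : Fin m) : 0 ≤ S.qtil (t + 1) i j := by
  rw [qtil_succ, mix_apply]
  exact Finset.sum_nonneg fun k _ => mul_nonneg (S.hWnonneg t i k) (S.q_nonneg t k j)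

lemma norm_sub_le_dX {y z : ∀ i, EuclideanSpace ℝ (Fin (p i))} (hy : ∀ i, y i ∈ S.X i)
    (hz : ∀ i, z i ∈ S.X i) (i : Fin n) : ‖y i - z i‖ ≤ S.dX :=
  (PiLp.norm_apply_le (stack y - stack z) i).trans (S.hdiam (stack y) (stack z) hy hz)

lemma B1_nonneg : 0 ≤ S.B1 := by
  have := S.hF
  have := S.hG
  have := S.hdX
  rw [B1]
  positivity

lemma sigmin_le (i : Fin n) : S.sigmin ≤ S.σ i := Finset.inf'_le _ (Finset.mem_univ i)

lemma sigmin_pos : 0 < S.sigmin := by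
  rw [sigmin, Finset.lt_inf'_iff]
  exact fun i _ => S.hσ i

lemma sigmin_mul_le_breg {i : Fin n} {y z : EuclideanSpace ℝ (Fin (p i))} (hy : y ∈ S.X i)
    (hz : z ∈ S.X i) : S.sigmin / 2 * ‖y - z‖ ^ 2 ≤ breg (S.ψ i) (S.ψ' i) y z := by
  have h1 := S.hψstrong i y hy z hz
  have h2 : S.sigmin / 2 * ‖y - z‖ ^ 2 ≤ S.σ i / 2 * ‖y - z‖ ^ 2 := by
    gcongr
    exact S.sigmin_le i
  rw [breg]
  linarith

lemma breg_nonneg {i : Fin n} {y z : EuclideanSpace ℝ (Fin (p i))} (hy : y ∈ S.X i)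
    (hz : z ∈ S.X i) : 0 ≤ breg (S.ψ i) (S.ψ' i) y z :=
  (mul_nonneg (half_pos S.sigmin_pos).le (sq_nonneg _)).trans (S.sigmin_mul_le_breg hy hz)

lemma breg_le {i : Fin n} {y z : EuclideanSpace ℝ (Fin (p i))} (hy : y ∈ S.X i)
    (hz : z ∈ S.X i) : breg (S.ψ i) (S.ψ' i) y z ≤ S.K * ‖y - z‖ := by
  have h := (le_abs_self _).trans (S.hbregLip i y hy z hz z hz)
  have h0 : breg (S.ψ i) (S.ψ' i) z z = 0 := by simp [breg]
  linarith

lemma neg_le_inner_sub {i : Fin n} {v z u : EuclideanSpace ℝ (Fin (p i))} (hv : ‖v‖ ≤ S.G) :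
    -(S.G * ‖u - z‖) ≤ ⟪v, u - z⟫ := by
  have h1 := (abs_le.1 (abs_real_inner_le_norm v (u - z))).1
  have h2 := mul_le_mul_of_nonneg_right hv (norm_nonneg (u - z))
  linarith

/-- The cost of one agent varies by at most `2F + G‖z - u‖` below its value at `z`. -/
lemma cost_sub_le (t : ℕ) {i : Fin n} {u z : EuclideanSpace ℝ (Fin (p i))} (hu : u ∈ S.X i)
    (hz : z ∈ S.X i) :
    S.f t i z + S.r t i z - (S.f t i u + S.r t i u) ≤ 2 * S.F + S.G * ‖u - z‖ := by
  have h1 := S.hGfsub t i z hz u hu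
  have h2 := S.hGrsub t i z hz u hu
  have h3 := S.neg_le_inner_sub (u := u) (z := z) (S.hGfbound t i z hz)
  have h4 := S.neg_le_inner_sub (u := u) (z := z) (S.hGrbound t i z hz)
  have h5 := abs_le.1 (S.hfbound t i z hz)
  have h6 := abs_le.1 (S.hfbound t i u hu)
  have h7 := abs_le.1 (S.hrbound t i z hz)
  have h8 := abs_le.1 (S.hrbound t i u hu)
  linarith

section Identity

variable {S}

lemma xtil_eq (hΦid : ∀ t i z, S.Φ t i z = z) (t : ℕ) (i : Fin n) :
    S.xtil (t + 1) i = S.x (t + 1) i := by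
  rw [S.hx (t + 1) (by omega), hΦid]

lemma b_succ (hΦid : ∀ t i z, S.Φ t i z = z) (t : ℕ) (i : Fin n) :
    S.b (t + 1) i =
      vecOf (fun j => ⟪S.Gg t i (S.x t i) j, S.x (t + 1) i - S.x t i⟫) + S.g t i (S.x t i) := by
  rw [S.hb (t + 1) (by omega), xtil_eq hΦid]
  rfl

lemma b_le (hΦid : ∀ t i z, S.Φ t i z = z) (t : ℕ) (i : Fin n) (j : Fin m) :
    S.b (t + 1) i j ≤ S.g t i (S.x (t + 1) i) j := by
  rw [b_succ hΦid]
  have := S.hGgsub t i _ (S.x_mem t i) j _ (S.x_mem (t + 1) i)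
  simp only [PiLp.add_apply, vecOf_apply]
  linarith

lemma beta_mul_norm_qtil_le (hΦid : ∀ t i z, S.Φ t i z = z)
    (hγβ : ∀ t, 1 ≤ t → S.γ t * S.β t ≤ 1) (t : ℕ) (i : Fin n) :
    S.β (t + 1) * ‖S.qtil (t + 1) i‖ ≤ S.F := by
  have hqtil : ∀ t, (∀ i, S.β (t + 1) * ‖S.q t i‖ ≤ S.F) →
      ∀ i, S.β (t + 1) * ‖S.qtil (t + 1) i‖ ≤ S.F := by
    intro t ht i
    have hβ := S.hβpos (t + 1) (by omega)
    rw [qtil_succ, mix]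
    calc S.β (t + 1) * ‖∑ j, S.W t i j • S.q t j‖
        ≤ S.β (t + 1) * ∑ j, S.W t i j * ‖S.q t j‖ := by
          gcongr
          refine norm_sum_le_of_le _ fun j _ => ?_
          rw [norm_smul, Real.norm_of_nonneg (S.hWnonneg t i j)]
      _ = ∑ j, S.W t i j * (S.β (t + 1) * ‖S.q t j‖) := by
          rw [Finset.mul_sum]
          exact Finset.sum_congr rfl fun j _ => by ring
      _ ≤ ∑ j, S.W t i j * S.F := Finset.sum_le_sum fun j _ =>
          mul_le_mul_of_nonneg_left (ht j) (S.hWnonneg t i j)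
      _ = S.F := by rw [← Finset.sum_mul, S.hWrow, one_mul]
  refine hqtil t ?_ i
  clear i
  induction t with
  | zero => intro i; simpa [S.hq0] using S.hF.le
  | succ t ih =>
    intro i
    have hβ := S.hβpos (t + 1) (by omega)
    have hγ := S.hγpos (t + 1) (by omega)
    have hle : ‖S.q (t + 1) i‖ ≤ ‖(1 - S.γ (t + 1) * S.β (t + 1)) • S.qtil (t + 1) i +
        S.γ (t + 1) • S.g t i (S.x (t + 1) i)‖ := by
      refine norm_le_norm_of_abs_le fun j => ?_
      rw [abs_of_nonneg (S.q_nonneg _ _ _), S.hq (t + 1) (by omega)]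
      refine max_le (le_trans ?_ (le_abs_self _)) (abs_nonneg _)
      have := mul_le_mul_of_nonneg_left (b_le hΦid t i j) hγ.le
      simp only [PiLp.add_apply, PiLp.smul_apply, PiLp.sub_apply, smul_eq_mul]
      linarith
    have hle' : ‖S.q (t + 1) i‖ ≤ (1 - S.γ (t + 1) * S.β (t + 1)) * ‖S.qtil (t + 1) i‖ +
        S.γ (t + 1) * S.F := by
      refine (hle.trans (norm_add_le _ _)).trans ?_
      rw [norm_smul, norm_smul, Real.norm_of_nonneg (sub_nonneg.2 (hγβ _ (by omega))),
        Real.norm_of_nonneg hγ.le]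
      gcongr
      exact S.hgbound t i _ (S.x_mem _ _)
    calc S.β (t + 1 + 1) * ‖S.q (t + 1) i‖ ≤ S.β (t + 1) * ‖S.q (t + 1) i‖ := by
          gcongr
          exact S.hβanti _ _ (by omega) (by omega)
      _ ≤ S.β (t + 1) * ((1 - S.γ (t + 1) * S.β (t + 1)) * ‖S.qtil (t + 1) i‖ +
            S.γ (t + 1) * S.F) := by gcongr
      _ = (1 - S.γ (t + 1) * S.β (t + 1)) * (S.β (t + 1) * ‖S.qtil (t + 1) i‖) +
            S.γ (t + 1) * S.β (t + 1) * S.F := by ring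
      _ ≤ (1 - S.γ (t + 1) * S.β (t + 1)) * S.F + S.γ (t + 1) * S.β (t + 1) * S.F := by
          gcongr
          · exact sub_nonneg.2 (hγβ _ (by omega))
          · exact hqtil t ih i
      _ = S.F := by ring

lemma norm_b_sub_le (hΦid : ∀ t i z, S.Φ t i z = z)
    (hγβ : ∀ t, 1 ≤ t → S.γ t * S.β t ≤ 1) (t : ℕ) (i : Fin n) :
    ‖S.b (t + 1) i - S.β (t + 1) • S.qtil (t + 1) i‖ ≤ S.B1 := by
  have h1 := S.hGgbound t i _ (S.x_mem t i) (S.x (t + 1) i - S.x t i)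
  have h2 := mul_le_mul_of_nonneg_left (S.norm_sub_le_dX (S.x_mem (t + 1)) (S.x_mem t) i) S.hG.le
  have h3 := S.hgbound t i _ (S.x_mem t i)
  have h4 : ‖S.β (t + 1) • S.qtil (t + 1) i‖ ≤ S.F := by
    rw [norm_smul, Real.norm_of_nonneg (S.hβpos _ (by omega)).le]
    exact beta_mul_norm_qtil_le hΦid hγβ t i
  rw [b_succ hΦid, B1]
  refine (norm_sub_le _ _).trans ?_
  have h5 := norm_add_le (vecOf fun j => ⟪S.Gg t i (S.x t i) j, S.x (t + 1) i - S.x t i⟫)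
    (S.g t i (S.x t i))
  linarith

lemma norm_q_sub_qtil_le (hΦid : ∀ t i z, S.Φ t i z = z)
    (hγβ : ∀ t, 1 ≤ t → S.γ t * S.β t ≤ 1) (t : ℕ) (i : Fin n) :
    ‖S.q (t + 1) i - mix (S.W t) (S.q t) i‖ ≤ S.γ (t + 1) * S.B1 := by
  rw [← qtil_succ, S.hq (t + 1) (by omega)]
  refine (norm_posPart_sub_le _ (S.qtil_nonneg t i)).trans ?_
  rw [add_sub_cancel_left, norm_smul, Real.norm_of_nonneg (S.hγpos _ (by omega)).le]
  exact mul_le_mul_of_nonneg_left (norm_b_sub_le hΦid hγβ t i) (S.hγpos _ (by omega)).le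

lemma q_one (hΦid : ∀ t i z, S.Φ t i z = z) (i : Fin n) : S.q 1 i = 0 := by
  have hqtil : S.qtil 1 i = 0 := by
    rw [S.qtil_succ 0]
    simp [mix, S.hq0]
  rw [S.hq 1 le_rfl, hqtil]
  ext j
  have hb : S.b 1 i j ≤ 0 := by simpa [S.hg0] using b_le hΦid 0 i j
  simpa using mul_nonpos_of_nonneg_of_nonpos (S.hγpos 1 le_rfl).le hb

/-- Primal part of the one-step analysis of a single agent. -/
lemma primal_step_le (hΦid : ∀ t i z, S.Φ t i z = z) (t : ℕ) (i : Fin n)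
    {z : EuclideanSpace ℝ (Fin (p i))} (hz : z ∈ S.X i) :
    S.f t i (S.x t i) + S.r t i (S.x t i) - (S.f t i z + S.r t i z) ≤
      2 * S.G * ‖S.x (t + 1) i - S.x t i‖ +
      (breg (S.ψ i) (S.ψ' i) z (S.x t i) - breg (S.ψ i) (S.ψ' i) z (S.x (t + 1) i) -
        S.sigmin / 2 * ‖S.x (t + 1) i - S.x t i‖ ^ 2) / S.α (t + 1) -
      ⟪S.qtil (t + 1) i, S.b (t + 1) i⟫ + ⟪S.qtil (t + 1) i, S.g t i z⟫ := by
  have hx := S.x_mem t i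
  have hx' := S.x_mem (t + 1) i
  have hα := S.hαpos (t + 1) (by omega)
  have hf := S.hGfsub t i _ hx z hz
  have hr := S.hGrsub t i _ hx _ hx'
  have hGf := S.neg_le_inner_sub (u := S.x (t + 1) i) (z := S.x t i) (S.hGfbound t i _ hx)
  have hGr := S.neg_le_inner_sub (u := S.x (t + 1) i) (z := S.x t i) (S.hGrbound t i _ hx)
  have hstep := mirror_descent_step (a := S.a (t + 1) i) (x := S.x t i) (S.hrconvex t i)
    (S.hψgrad i (S.x (t + 1) i)) hα.le hx' hz fun u hu => by
      have := S.hxtilmin (t + 1) (by omega) i u hu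
      rwa [xtil_eq hΦid] at this
  have hσ := S.sigmin_mul_le_breg hx' hx
  have ha : ⟪S.x (t + 1) i - z, S.a (t + 1) i⟫ = ⟪S.Gf t i (S.x t i), S.x (t + 1) i - z⟫ +
      ∑ j, S.qtil (t + 1) i j * ⟪S.Gg t i (S.x t i) j, S.x (t + 1) i - z⟫ := by
    rw [S.ha (t + 1) (by omega), real_inner_comm, inner_add_left, sum_inner]
    simp only [real_inner_smul_left]
    rfl
  have hdual : ⟪S.qtil (t + 1) i, S.b (t + 1) i⟫ - ⟪S.qtil (t + 1) i, S.g t i z⟫ ≤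
      ∑ j, S.qtil (t + 1) i j * ⟪S.Gg t i (S.x t i) j, S.x (t + 1) i - z⟫ := by
    rw [← inner_sub_right, inner_eq_sum]
    refine Finset.sum_le_sum fun j _ => mul_le_mul_of_nonneg_left ?_ (S.qtil_nonneg t i j)
    have h := S.hGgsub t i _ hx j z hz
    rw [b_succ hΦid]
    simp only [PiLp.sub_apply, PiLp.add_apply, vecOf_apply, inner_sub_right] at h ⊢
    linarith
  have hdiv : ⟪S.x (t + 1) i - z, S.a (t + 1) i⟫ + (S.r t i (S.x (t + 1) i) - S.r t i z) ≤
      (breg (S.ψ i) (S.ψ' i) z (S.x t i) - breg (S.ψ i) (S.ψ' i) z (S.x (t + 1) i) -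
        S.sigmin / 2 * ‖S.x (t + 1) i - S.x t i‖ ^ 2) / S.α (t + 1) := by
    rw [le_div_iff₀ hα]
    linarith
  simp only [inner_sub_right] at *
  linarith

/-- Dual part of the one-step analysis of a single agent. -/
lemma dual_step_le (hΦid : ∀ t i z, S.Φ t i z = z) (hγβ : ∀ t, 1 ≤ t → S.γ t * S.β t ≤ 1)
    (t : ℕ) (i : Fin n) {y : EuclideanSpace ℝ (Fin m)} (hy : ∀ j, 0 ≤ y j) :
    -⟪S.qtil (t + 1) i, S.b (t + 1) i⟫ ≤
      ((S.γ (t + 1))⁻¹ - S.β (t + 1)) / 2 * ‖S.qtil (t + 1) i - y‖ ^ 2 -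
      (S.γ (t + 1))⁻¹ / 2 * ‖S.q (t + 1) i - y‖ ^ 2 + S.γ (t + 1) * S.B1 ^ 2 / 2 +
      S.β (t + 1) / 2 * ‖y‖ ^ 2 - ⟪y, S.g t i (S.x t i)⟫ +
      S.G * ‖y‖ * ‖S.x (t + 1) i - S.x t i‖ := by
  have hγ := S.hγpos (t + 1) (by omega)
  have hβ := S.hβpos (t + 1) (by omega)
  have hB := norm_b_sub_le hΦid hγβ t i
  set v := vecOf fun j => ⟪S.Gg t i (S.x t i) j, S.x (t + 1) i - S.x t i⟫
  have hv : ‖v‖ ≤ S.G * ‖S.x (t + 1) i - S.x t i‖ := S.hGgbound t i _ (S.x_mem t i) _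
  have hyv : -(S.G * ‖y‖ * ‖S.x (t + 1) i - S.x t i‖) ≤ ⟪y, v⟫ := by
    have h1 := (abs_le.1 (abs_real_inner_le_norm y v)).1
    have h2 := mul_le_mul_of_nonneg_left hv (norm_nonneg y)
    linarith
  have hyb : ⟪y, S.b (t + 1) i⟫ = ⟪y, v⟫ + ⟪y, S.g t i (S.x t i)⟫ := by
    rw [b_succ hΦid, inner_add_right]
  set q := S.qtil (t + 1) i
  set b := S.b (t + 1) i
  set c := S.γ (t + 1)
  set e := S.β (t + 1)
  have hq : ‖S.q (t + 1) i - y‖ ^ 2 ≤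
      ‖q - y‖ ^ 2 + 2 * c * ⟪q - y, b - e • q⟫ + c ^ 2 * S.B1 ^ 2 := by
    calc ‖S.q (t + 1) i - y‖ ^ 2 ≤ ‖q + c • (b - e • q) - y‖ ^ 2 := by
          rw [S.hq (t + 1) (by omega)]
          exact pow_le_pow_left₀ (norm_nonneg _) (norm_posPart_sub_le _ hy) 2
      _ = ‖q - y‖ ^ 2 + 2 * c * ⟪q - y, b - e • q⟫ + c ^ 2 * ‖b - e • q‖ ^ 2 := by
          rw [add_sub_right_comm, norm_add_sq_real, real_inner_smul_right, norm_smul, mul_pow,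
            Real.norm_eq_abs, sq_abs]
          ring
      _ ≤ _ := by gcongr
  have hin : ⟪q - y, b - e • q⟫ = ⟪q, b⟫ - ⟪y, b⟫ -
      e / 2 * (‖q‖ ^ 2 - ‖y‖ ^ 2 + ‖q - y‖ ^ 2) := by
    rw [norm_sub_sq_real]
    simp only [inner_sub_left, inner_sub_right, real_inner_smul_right,
      real_inner_self_eq_norm_sq, real_inner_comm q y]
    ring
  have hdiv : c⁻¹ / 2 * ‖S.q (t + 1) i - y‖ ^ 2 ≤
      c⁻¹ / 2 * ‖q - y‖ ^ 2 + ⟪q - y, b - e • q⟫ + c * S.B1 ^ 2 / 2 := by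
    calc c⁻¹ / 2 * ‖S.q (t + 1) i - y‖ ^ 2 ≤ c⁻¹ / 2 *
          (‖q - y‖ ^ 2 + 2 * c * ⟪q - y, b - e • q⟫ + c ^ 2 * S.B1 ^ 2) := by gcongr
      _ = _ := by field_simp
  have hqq : 0 ≤ e / 2 * ‖q‖ ^ 2 := by positivity
  rw [hin] at hdiv
  linarith

/-- One-step inequality for a single agent, for a primal comparator `z` and a dual one `y`. -/
lemma agent_step_le (hΦid : ∀ t i z, S.Φ t i z = z) (hγβ : ∀ t, 1 ≤ t → S.γ t * S.β t ≤ 1)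
    (t : ℕ) (i : Fin n) {z : EuclideanSpace ℝ (Fin (p i))} (hz : z ∈ S.X i)
    {y : EuclideanSpace ℝ (Fin m)} (hy : ∀ j, 0 ≤ y j) :
    S.f t i (S.x t i) + S.r t i (S.x t i) - (S.f t i z + S.r t i z) +
        ⟪y, S.g t i (S.x t i)⟫ ≤
      (S.α (t + 1))⁻¹ *
        (breg (S.ψ i) (S.ψ' i) z (S.x t i) - breg (S.ψ i) (S.ψ' i) z (S.x (t + 1) i)) +
      (4 + ‖y‖ ^ 2) * (S.G ^ 2 / S.sigmin) * S.α (t + 1) + ⟪S.qtil (t + 1) i, S.g t i z⟫ +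
      ((S.γ (t + 1))⁻¹ - S.β (t + 1)) / 2 * ‖S.qtil (t + 1) i - y‖ ^ 2 -
      (S.γ (t + 1))⁻¹ / 2 * ‖S.q (t + 1) i - y‖ ^ 2 + S.γ (t + 1) * S.B1 ^ 2 / 2 +
      S.β (t + 1) / 2 * ‖y‖ ^ 2 := by
  have h1 := primal_step_le hΦid t i hz
  have h2 := dual_step_le hΦid hγβ t i hy
  have hα := S.hαpos (t + 1) (by omega)
  have hσ := S.sigmin_pos
  set δ := ‖S.x (t + 1) i - S.x t i‖
  have hyoung : (2 + ‖y‖) * S.G * δ ≤ S.sigmin / 2 * δ ^ 2 / S.α (t + 1) +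
      (4 + ‖y‖ ^ 2) * (S.G ^ 2 / S.sigmin) * S.α (t + 1) := by
    have h : S.sigmin / 2 * δ ^ 2 / S.α (t + 1) +
        (4 + ‖y‖ ^ 2) * (S.G ^ 2 / S.sigmin) * S.α (t + 1) - (2 + ‖y‖) * S.G * δ =
        ((S.sigmin * δ - (2 + ‖y‖) * S.G * S.α (t + 1)) ^ 2 +
          ((2 - ‖y‖) * S.G * S.α (t + 1)) ^ 2) / (2 * S.sigmin * S.α (t + 1)) := by
      field_simp
      ring
    have : 0 ≤ ((S.sigmin * δ - (2 + ‖y‖) * S.G * S.α (t + 1)) ^ 2 +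
        ((2 - ‖y‖) * S.G * S.α (t + 1)) ^ 2) / (2 * S.sigmin * S.α (t + 1)) := by positivity
    linarith
  rw [sub_div _ (S.sigmin / 2 * δ ^ 2), div_eq_inv_mul (_ - _)] at h1
  linarith

lemma sum_norm_qtil_sub_sq_le (t : ℕ) (y : EuclideanSpace ℝ (Fin m)) :
    ∑ i, ‖S.qtil (t + 1) i - y‖ ^ 2 ≤ ∑ i, ‖S.q t i - y‖ ^ 2 := by
  have h : ∀ i, ‖S.qtil (t + 1) i - y‖ ^ 2 ≤ ∑ j, S.W t i j * ‖S.q t j - y‖ ^ 2 := by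
    intro i
    have heq : S.qtil (t + 1) i - y = ∑ j, S.W t i j • (S.q t j - y) := by
      simp only [smul_sub, Finset.sum_sub_distrib, ← Finset.sum_smul, S.hWrow, one_smul]
      rw [qtil_succ, mix]
    have hnorm : ‖S.qtil (t + 1) i - y‖ ≤ ∑ j, S.W t i j * ‖S.q t j - y‖ := by
      rw [heq]
      refine norm_sum_le_of_le _ fun j _ => ?_
      rw [norm_smul, Real.norm_of_nonneg (S.hWnonneg t i j)]
    exact (pow_le_pow_left₀ (norm_nonneg _) hnorm 2).trans
      (Real.pow_arith_mean_le_arith_mean_pow _ _ _ (fun j _ => S.hWnonneg t i j) (S.hWrow t i)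
        (fun j _ => norm_nonneg _) 2)
  refine (Finset.sum_le_sum fun i _ => h i).trans_eq ?_
  rw [Finset.sum_comm]
  simp [← Finset.sum_mul, S.hWcol]

lemma sum_inner_qtil_le (t : ℕ) {z : ∀ i, EuclideanSpace ℝ (Fin (p i))}
    (hz : ∀ i, z i ∈ S.X i) (hfeas : ∀ j, S.gsum t z j ≤ 0) :
    ∑ i, ⟪S.qtil (t + 1) i, S.g t i (z i)⟫ ≤ S.F * (√n * ‖centered (S.q t)‖) := by
  set μ := (n : ℝ)⁻¹ • ∑ j, S.qtil (t + 1) j with hμ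
  have hμ0 : ∀ j, 0 ≤ μ j := by
    intro j
    have : μ j = (n : ℝ)⁻¹ * ∑ k, S.qtil (t + 1) k j := by simp [hμ]
    rw [this]
    exact mul_nonneg (by positivity) (Finset.sum_nonneg fun k _ => S.qtil_nonneg t k j)
  have hμg : ⟪μ, S.gsum t z⟫ ≤ 0 := by
    rw [inner_eq_sum]
    exact Finset.sum_nonpos fun j _ => mul_nonpos_of_nonneg_of_nonpos (hμ0 j) (hfeas j)
  have hsplit : ∑ i, ⟪S.qtil (t + 1) i, S.g t i (z i)⟫ =
      ∑ i, ⟪S.qtil (t + 1) i - μ, S.g t i (z i)⟫ + ⟪μ, S.gsum t z⟫ := by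
    rw [gsum, inner_sum, ← Finset.sum_add_distrib]
    exact Finset.sum_congr rfl fun i _ => by rw [inner_sub_left]; ring
  have hdev : ∑ i, ⟪S.qtil (t + 1) i - μ, S.g t i (z i)⟫ ≤
      S.F * ∑ i, ‖S.qtil (t + 1) i - μ‖ := by
    rw [Finset.mul_sum]
    refine Finset.sum_le_sum fun i _ => (real_inner_le_norm _ _).trans ?_
    rw [mul_comm]
    exact mul_le_mul_of_nonneg_right (S.hgbound t i _ (hz i)) (norm_nonneg _)
  have hq : S.qtil (t + 1) = mix (S.W t) (S.q t) := funext (S.qtil_succ t)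
  have hnorm : ∑ i, ‖S.qtil (t + 1) i - μ‖ ≤ √n * ‖centered (S.q t)‖ := by
    refine (sum_norm_sub_mean_le _).trans ?_
    rw [hq]
    exact mul_le_mul_of_nonneg_left (norm_centered_mix_le S.hn (S.hWnonneg t) (S.hWrow t)
      (S.hWcol t) _) (Real.sqrt_nonneg _)
  have := mul_le_mul_of_nonneg_left hnorm S.hF.le
  linarith

/-- One-step inequality for the whole network. -/
lemma network_step_le (hΦid : ∀ t i z, S.Φ t i z = z) (hγβ : ∀ t, 1 ≤ t → S.γ t * S.β t ≤ 1)
    (t : ℕ) {z : ∀ i, EuclideanSpace ℝ (Fin (p i))} (hz : ∀ i, z i ∈ S.X i)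
    (hfeas : ∀ j, S.gsum t z j ≤ 0) {y : EuclideanSpace ℝ (Fin m)} (hy : ∀ j, 0 ≤ y j) :
    S.fsum t (S.x t) - S.fsum t z + ⟪y, S.gsum t (S.x t)⟫ ≤
      (S.α (t + 1))⁻¹ * (∑ i, breg (S.ψ i) (S.ψ' i) (z i) (S.x t i) -
        ∑ i, breg (S.ψ i) (S.ψ' i) (z i) (S.x (t + 1) i)) +
      n * ((4 + ‖y‖ ^ 2) * (S.G ^ 2 / S.sigmin)) * S.α (t + 1) +
      S.F * (√n * ‖centered (S.q t)‖) +
      ((S.γ (t + 1))⁻¹ - S.β (t + 1)) / 2 * ∑ i, ‖S.q t i - y‖ ^ 2 -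
      (S.γ (t + 1))⁻¹ / 2 * ∑ i, ‖S.q (t + 1) i - y‖ ^ 2 + n * S.B1 ^ 2 / 2 * S.γ (t + 1) +
      n / 2 * ‖y‖ ^ 2 * S.β (t + 1) := by
  have hcoef : 0 ≤ ((S.γ (t + 1))⁻¹ - S.β (t + 1)) / 2 := by
    have hγ := S.hγpos (t + 1) (by omega)
    have : S.β (t + 1) ≤ (S.γ (t + 1))⁻¹ := by
      rw [← one_div, le_div_iff₀ hγ, mul_comm]
      exact hγβ _ (by omega)
    linarith
  have hq := mul_le_mul_of_nonneg_left (S.sum_norm_qtil_sub_sq_le t y) hcoef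
  have hin := S.sum_inner_qtil_le t hz hfeas
  have hsum := Finset.sum_le_sum fun i (_ : i ∈ Finset.univ) =>
    agent_step_le hΦid hγβ t i (hz i) hy
  simp only [Finset.sum_add_distrib, Finset.sum_sub_distrib, ← Finset.mul_sum, Finset.sum_const,
    Finset.card_univ, Fintype.card_fin, nsmul_eq_mul, ← inner_sum] at hsum
  simp only [fsum, gsum, Finset.sum_add_distrib]
  linarith

lemma sum_norm_centered_q_le (hΦid : ∀ t i z, S.Φ t i z = z)
    (hγβ : ∀ t, 1 ≤ t → S.γ t * S.β t ≤ 1) (T : ℕ) :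
    √n * ∑ t ∈ Finset.range T, ‖centered (S.q (t + 1))‖ ≤
      (S.iota * (n : ℝ) ^ 3 / S.w) * (n * (S.B1 * ∑ t ∈ Finset.range T, S.γ (t + 1))) := by
  have h := sum_norm_centered_le S.hn S.hWnonneg S.hWrow S.hWcol S.hw0 S.hw1.le S.hWdiag S.hWpos
    S.hconn S.hq0 (fun t i => norm_q_sub_qtil_le hΦid hγβ t i) T
  rw [Finset.sum_range_succ'] at h
  have h0 := norm_nonneg (centered (S.q 0))
  have hn : √(n : ℝ) * √n = n := Real.mul_self_sqrt (Nat.cast_nonneg n)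
  calc √(n : ℝ) * ∑ t ∈ Finset.range T, ‖centered (S.q (t + 1))‖ ≤
        √n * (S.iota * (n : ℝ) ^ 3 / S.w *
          (√n * ∑ t ∈ Finset.range T, S.γ (t + 1) * S.B1)) := by
        gcongr
        linarith
    _ = S.iota * (n : ℝ) ^ 3 / S.w *
          ((√n * √n) * ∑ t ∈ Finset.range T, S.γ (t + 1) * S.B1) := by ring
    _ = _ := by rw [hn, ← Finset.sum_mul, mul_comm S.B1]

end Identity

lemma scaled_weight_pos : 0 < S.w / (2 * (n : ℝ) ^ 2) := by
  have hn : (0 : ℝ) < n := by exact_mod_cast S.hn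
  have := S.hw0
  positivity

lemma scaled_weight_lt_one : S.w / (2 * (n : ℝ) ^ 2) < 1 := by
  have hn : (1 : ℝ) ≤ n := by exact_mod_cast S.hn
  rw [div_lt_one (by positivity)]
  nlinarith [S.hw1]

lemma lam_pos : 0 < S.lam :=
  Real.rpow_pos_of_pos (sub_pos.2 S.scaled_weight_lt_one) _

lemma lam_lt_one : S.lam < 1 :=
  Real.rpow_lt_one (sub_pos.2 S.scaled_weight_lt_one).le (sub_lt_self _ S.scaled_weight_pos)
    (inv_pos.2 (by exact_mod_cast S.hiota))

lemma tau_pos : 0 < S.tau :=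
  inv_pos.2 (pow_pos (sub_pos.2 S.scaled_weight_lt_one) 2)

/-- The mixing constant is dominated by the constants `τ` and `λ`. -/
lemma iota_mul_le : S.iota * (n : ℝ) ^ 3 / S.w ≤ n * S.tau / (1 - S.lam) := by
  have hn : (0 : ℝ) < n := by exact_mod_cast S.hn
  have hw := S.hw0
  have hc1 := S.scaled_weight_pos
  have hc0 := S.scaled_weight_lt_one
  have hlam0 := S.lam_pos
  have hlam1 := S.lam_lt_one
  have htau0 := S.tau_pos
  have hpow : S.lam ^ S.iota = 1 - S.w / (2 * (n : ℝ) ^ 2) :=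
    Real.rpow_inv_natCast_pow (by linarith) S.hiota.ne'
  have htau : S.tau = (1 - S.w / (2 * (n : ℝ) ^ 2))⁻¹ ^ 2 := by rw [inv_pow]; rfl
  have hkey : S.iota * (1 - S.lam) ≤ S.tau * (S.w / (2 * (n : ℝ) ^ 2)) := by
    rw [htau]
    set c := 1 - S.w / (2 * (n : ℝ) ^ 2) with hc
    have hbern : 1 + S.iota * (S.lam⁻¹ - 1) ≤ c⁻¹ := by
      rw [← hpow, ← inv_pow]
      exact one_add_mul_sub_le_pow (by linarith [inv_pos.2 hlam0]) _
    have hinv : 1 - S.lam ≤ S.lam⁻¹ - 1 := by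
      have : S.lam * S.lam⁻¹ = 1 := mul_inv_cancel₀ hlam0.ne'
      nlinarith [sq_nonneg (S.lam - 1), inv_pos.2 hlam0]
    have hcc : c * c⁻¹ = 1 := mul_inv_cancel₀ (by linarith)
    have hci : 1 < c⁻¹ := (one_lt_inv₀ (by linarith)).2 (by linarith)
    have hι : (0 : ℝ) < S.iota := by exact_mod_cast S.hiota
    have h1 : S.iota * (1 - S.lam) ≤ c⁻¹ - 1 := by nlinarith
    have h2 : c⁻¹ - 1 ≤ c⁻¹ ^ 2 * (1 - c) := by nlinarith
    have h3 : S.w / (2 * (n : ℝ) ^ 2) = 1 - c := by rw [hc]; ring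
    rw [h3]
    exact h1.trans h2
  rw [div_le_div_iff₀ hw (by linarith)]
  calc S.iota * (n : ℝ) ^ 3 * (1 - S.lam) = n ^ 3 * (S.iota * (1 - S.lam)) := by ring
    _ ≤ n ^ 3 * (S.tau * (S.w / (2 * (n : ℝ) ^ 2))) := by gcongr
    _ = n * S.tau * S.w / 2 := by field_simp
    _ ≤ n * S.tau * S.w := by
      have : 0 < n * S.tau * S.w := by positivity
      linarith

lemma C12_nonneg : 0 ≤ S.C12 := by
  have := S.sigmin_pos
  have := S.hG
  unfold C12
  positivity

lemma half_mul_B1_sq_le_C11 : n * S.B1 ^ 2 / 2 ≤ S.C11 := by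
  have h := sub_pos.2 S.lam_lt_one
  have := S.tau_pos
  have := S.B1_nonneg
  have := S.hF
  have h0 : 0 ≤ 3 * (n : ℝ) ^ 2 * S.tau * S.B1 * S.F / (1 - S.lam) := by positivity
  unfold C11
  linarith

lemma sum_breg_nonneg {y z : ∀ i, EuclideanSpace ℝ (Fin (p i))} (hy : ∀ i, y i ∈ S.X i)
    (hz : ∀ i, z i ∈ S.X i) : 0 ≤ ∑ i, breg (S.ψ i) (S.ψ' i) (y i) (z i) :=
  Finset.sum_nonneg fun i _ => S.breg_nonneg (hy i) (hz i)

lemma sum_breg_le {y z : ∀ i, EuclideanSpace ℝ (Fin (p i))} (hy : ∀ i, y i ∈ S.X i)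
    (hz : ∀ i, z i ∈ S.X i) :
    ∑ i, breg (S.ψ i) (S.ψ' i) (y i) (z i) ≤ n * (S.K * S.dX) := by
  have h : ∀ i ∈ Finset.univ, breg (S.ψ i) (S.ψ' i) (y i) (z i) ≤ S.K * S.dX := fun i _ =>
    (S.breg_le (hy i) (hz i)).trans
      (mul_le_mul_of_nonneg_left (S.norm_sub_le_dX hy hz i) S.hK.le)
  simpa using Finset.sum_le_sum h

end Alg

section Sums

lemma sum_Icc_one_eq_sum_range {M : Type*} [AddCommMonoid M] (f : ℕ → M) (T : ℕ) :
    ∑ t ∈ Finset.Icc 1 T, f t = ∑ k ∈ Finset.range T, f (k + 1) := by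
  induction T with
  | zero => simp
  | succ T ih => rw [Finset.sum_Icc_succ_top (by omega), ih, Finset.sum_range_succ]

lemma sum_mul_sub_le {c D : ℕ → ℝ} {M : ℝ} (hc : Monotone c) (hc0 : 0 ≤ c 0)
    (hD : ∀ t, D t ≤ M) (T : ℕ) :
    ∑ t ∈ Finset.range T, c (t + 1) * (D t - D (t + 1)) ≤ c T * (M - D T) := by
  induction T with
  | zero => simpa using mul_nonneg hc0 (sub_nonneg.2 (hD 0))
  | succ T ih =>
    rw [Finset.sum_range_succ]
    have h := mul_le_mul_of_nonneg_right (hc T.le_succ) (sub_nonneg.2 (hD T))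
    simp only [Nat.succ_eq_add_one] at h
    linarith

lemma monotone_natCast_succ_rpow {κ : ℝ} (hκ : 0 ≤ κ) :
    Monotone fun k : ℕ => (((k + 1 : ℕ) : ℝ)) ^ κ := fun a b hab =>
  Real.rpow_le_rpow (by positivity) (by exact_mod_cast Nat.succ_le_succ hab) hκ

lemma inv_rpow_succ_le {κ : ℝ} (hκ : 0 ≤ κ) (k : ℕ) :
    (((k + 1 + 1 : ℕ) : ℝ) ^ κ)⁻¹ ≤ (((k + 1 : ℕ) : ℝ) ^ κ)⁻¹ :=
  inv_anti₀ (Real.rpow_pos_of_pos (by positivity) _) (monotone_natCast_succ_rpow hκ k.le_succ)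

lemma rpow_one_sub_sub_inv_rpow_le {κ : ℝ} (hκ : 0 ≤ κ) (k : ℕ) :
    ((k + 1 + 1 : ℕ) : ℝ) ^ (1 - κ) - (((k + 1 + 1 : ℕ) : ℝ) ^ κ)⁻¹ ≤
      ((k + 1 : ℕ) : ℝ) ^ (1 - κ) := by
  have h1 : (0 : ℝ) < ((k + 1 : ℕ) : ℝ) := by positivity
  have h2 : (0 : ℝ) < ((k + 1 + 1 : ℕ) : ℝ) := by positivity
  rw [Real.rpow_sub h1, Real.rpow_sub h2, Real.rpow_one, Real.rpow_one, ← one_div, ← sub_div]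
  have hp := Real.rpow_pos_of_pos h1 κ
  have hm := monotone_natCast_succ_rpow hκ k.le_succ
  simp only [Nat.succ_eq_add_one] at hm
  have he : ((k + 1 + 1 : ℕ) : ℝ) - 1 = ((k + 1 : ℕ) : ℝ) := by push_cast; ring
  rw [he]
  exact div_le_div_of_nonneg_left h1.le hp hm

end Sums

namespace Alg

section Stepsizes

variable {n m : ℕ} {p : Fin n → ℕ} {S : Alg n m p} {κ : ℝ}

lemma gamma_mul_beta_le (hβ : ∀ t : ℕ, 1 ≤ t → S.β t = ((t : ℝ) ^ κ)⁻¹)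
    (hγ : ∀ t : ℕ, 1 ≤ t → S.γ t = ((t : ℝ) ^ (1 - κ))⁻¹) (t : ℕ) (ht : 1 ≤ t) :
    S.γ t * S.β t ≤ 1 := by
  have ht' : (1 : ℝ) ≤ t := by exact_mod_cast ht
  rw [hβ t ht, hγ t ht, ← mul_inv, ← Real.rpow_add (by linarith), sub_add_cancel, Real.rpow_one]
  exact inv_le_one_of_one_le₀ ht'

lemma sum_dual_terms_le (hΦid : ∀ t i z, S.Φ t i z = z) (hκ0 : 0 < κ)
    (hβ : ∀ t : ℕ, 1 ≤ t → S.β t = ((t : ℝ) ^ κ)⁻¹)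
    (hγ : ∀ t : ℕ, 1 ≤ t → S.γ t = ((t : ℝ) ^ (1 - κ))⁻¹) (T : ℕ)
    (y : EuclideanSpace ℝ (Fin m)) :
    ∑ k ∈ Finset.range T, (((S.γ (k + 1 + 1))⁻¹ - S.β (k + 1 + 1)) / 2 *
        ∑ i, ‖S.q (k + 1) i - y‖ ^ 2 -
      (S.γ (k + 1 + 1))⁻¹ / 2 * ∑ i, ‖S.q (k + 1 + 1) i - y‖ ^ 2) ≤ n / 2 * ‖y‖ ^ 2 := by
  set Z : ℕ → ℝ := fun t => ((t + 1 : ℕ) : ℝ) ^ (1 - κ) / 2 * ∑ i, ‖S.q (t + 1) i - y‖ ^ 2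
  have hZ : ∀ t, 0 ≤ Z t := fun t => by positivity
  have hstep : ∀ k ∈ Finset.range T, ((S.γ (k + 1 + 1))⁻¹ - S.β (k + 1 + 1)) / 2 *
        ∑ i, ‖S.q (k + 1) i - y‖ ^ 2 -
      (S.γ (k + 1 + 1))⁻¹ / 2 * ∑ i, ‖S.q (k + 1 + 1) i - y‖ ^ 2 ≤ Z k - Z (k + 1) := by
    intro k _
    have hq : 0 ≤ ∑ i, ‖S.q (k + 1) i - y‖ ^ 2 := by positivity
    have h := mul_le_mul_of_nonneg_right (rpow_one_sub_sub_inv_rpow_le hκ0.le k) hq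
    rw [hβ _ (by omega), hγ _ (by omega), inv_inv]
    simp only [Z]
    linarith
  refine (Finset.sum_le_sum hstep).trans ?_
  rw [Finset.sum_range_sub']
  have h0 : Z 0 = n / 2 * ‖y‖ ^ 2 := by
    simp [Z, q_one hΦid]
    ring
  linarith [hZ T]

/-- The common estimate behind both the regret bound and the constraint violation bound. -/
lemma regret_add_inner_le (hΦid : ∀ t i z, S.Φ t i z = z) (hκ0 : 0 < κ) (hκ1 : κ < 1)
    (hα : ∀ t : ℕ, 1 ≤ t → S.α t = ((t : ℝ) ^ κ)⁻¹)
    (hβ : ∀ t : ℕ, 1 ≤ t → S.β t = ((t : ℝ) ^ κ)⁻¹)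
    (hγ : ∀ t : ℕ, 1 ≤ t → S.γ t = ((t : ℝ) ^ (1 - κ))⁻¹) {T : ℕ} (hT : 1 ≤ T)
    {z : ∀ i, EuclideanSpace ℝ (Fin (p i))} (hz : ∀ i, z i ∈ S.X i)
    (hfeas : ∀ t ∈ Finset.Icc 1 T, ∀ j, S.gsum t z j ≤ 0)
    {y : EuclideanSpace ℝ (Fin m)} (hy : ∀ j, 0 ≤ y j) :
    S.reg T (fun _ => z) + ⟪y, ∑ t ∈ Finset.Icc 1 T, S.gsum t (S.x t)⟫ ≤
      S.C11 / κ * (T : ℝ) ^ κ + S.C12 / (1 - κ) * (T : ℝ) ^ (1 - κ) +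
      n * S.K * S.dX * ((T : ℝ) + 1) ^ κ +
      n / 2 * (2 * S.G ^ 2 / ((1 - κ) * S.sigmin) + 1 / (1 - κ) + 2) * (T : ℝ) ^ (1 - κ) *
        ‖y‖ ^ 2 := by
  have hγβ := gamma_mul_beta_le hβ hγ
  have hκ1' : 0 < 1 - κ := sub_pos.2 hκ1
  have hσ := S.sigmin_pos
  have hF := S.hF
  have hB := S.B1_nonneg
  have hT' : (1 : ℝ) ≤ (T : ℝ) ^ (1 - κ) :=
    Real.one_le_rpow (by exact_mod_cast hT) hκ1'.le
  have hsum := Finset.sum_le_sum fun k (hk : k ∈ Finset.range T) =>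
    network_step_le hΦid hγβ (k + 1) hz
      (hfeas (k + 1) (by simp only [Finset.mem_range] at hk; simp; omega)) hy
  simp only [add_sub_assoc, Finset.sum_add_distrib, ← Finset.mul_sum] at hsum
  have hdual := sum_dual_terms_le hΦid hκ0 hβ hγ T y
  have hprimal : ∑ k ∈ Finset.range T, (S.α (k + 1 + 1))⁻¹ *
      (∑ i, breg (S.ψ i) (S.ψ' i) (z i) (S.x (k + 1) i) -
        ∑ i, breg (S.ψ i) (S.ψ' i) (z i) (S.x (k + 1 + 1) i)) ≤
      ((T : ℝ) + 1) ^ κ * (n * (S.K * S.dX)) := by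
    have h := sum_mul_sub_le (monotone_natCast_succ_rpow hκ0.le) (by positivity)
      (fun t => S.sum_breg_le hz (S.x_mem (t + 1))) T
    refine le_trans (Finset.sum_le_sum fun k _ => ?_) (h.trans ?_)
    · rw [hα _ (by omega), inv_inv]
    · push_cast
      exact mul_le_mul_of_nonneg_left
        (sub_le_self _ (S.sum_breg_nonneg hz (S.x_mem (T + 1)))) (by positivity)
  have hsumκ := sum_inv_rpow_le hκ0 hκ1 T
  have hsumκ' := sum_inv_rpow_le hκ1' (by linarith) T
  rw [sub_sub_cancel] at hsumκ'
  have hsumα : ∑ k ∈ Finset.range T, S.α (k + 1 + 1) ≤ (T : ℝ) ^ (1 - κ) / (1 - κ) :=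
    le_trans (Finset.sum_le_sum fun k _ => by
      rw [hα _ (by omega)]; exact inv_rpow_succ_le hκ0.le k) hsumκ
  have hsumβ : ∑ k ∈ Finset.range T, S.β (k + 1 + 1) ≤ (T : ℝ) ^ (1 - κ) / (1 - κ) :=
    le_trans (Finset.sum_le_sum fun k _ => by
      rw [hβ _ (by omega)]; exact inv_rpow_succ_le hκ0.le k) hsumκ
  have hsumγ : ∑ k ∈ Finset.range T, S.γ (k + 1 + 1) ≤ (T : ℝ) ^ κ / κ :=
    le_trans (Finset.sum_le_sum fun k _ => by
      rw [hγ _ (by omega)]; exact inv_rpow_succ_le hκ1'.le k) hsumκ'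
  have hsumγ' : ∑ k ∈ Finset.range T, S.γ (k + 1) ≤ (T : ℝ) ^ κ / κ :=
    le_trans (Finset.sum_le_sum fun k _ => by rw [hγ _ (by omega)]) hsumκ'
  have hnoise : S.F * (√n * ∑ k ∈ Finset.range T, ‖centered (S.q (k + 1))‖) ≤
      3 * (n : ℝ) ^ 2 * S.tau * S.B1 * S.F / (1 - S.lam) * ((T : ℝ) ^ κ / κ) := by
    have hlam := sub_pos.2 S.lam_lt_one
    have htau := S.tau_pos
    have h0 : 0 ≤ (n : ℝ) ^ 2 * S.tau * S.B1 * S.F / (1 - S.lam) * ((T : ℝ) ^ κ / κ) := by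
      positivity
    calc S.F * (√n * ∑ k ∈ Finset.range T, ‖centered (S.q (k + 1))‖) ≤
          S.F * ((n * S.tau / (1 - S.lam)) * (n * (S.B1 * ((T : ℝ) ^ κ / κ)))) := by
          refine mul_le_mul_of_nonneg_left
            ((sum_norm_centered_q_le hΦid hγβ T).trans ?_) hF.le
          refine mul_le_mul S.iota_mul_le (by gcongr) ?_ (by positivity)
          have := Finset.sum_nonneg fun k (_ : k ∈ Finset.range T) =>
            (S.hγpos (k + 1) (by omega)).le
          positivity
      _ = (n : ℝ) ^ 2 * S.tau * S.B1 * S.F / (1 - S.lam) * ((T : ℝ) ^ κ / κ) := by ring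
      _ ≤ _ := by
        rw [show 3 * (n : ℝ) ^ 2 * S.tau * S.B1 * S.F / (1 - S.lam) * ((T : ℝ) ^ κ / κ) =
          3 * ((n : ℝ) ^ 2 * S.tau * S.B1 * S.F / (1 - S.lam) * ((T : ℝ) ^ κ / κ)) by ring]
        linarith
  have hreg : ∑ k ∈ Finset.range T, (S.fsum (k + 1) (S.x (k + 1)) - S.fsum (k + 1) z) +
      ∑ k ∈ Finset.range T, ⟪y, S.gsum (k + 1) (S.x (k + 1))⟫ =
      S.reg T (fun _ => z) + ⟪y, ∑ t ∈ Finset.Icc 1 T, S.gsum t (S.x t)⟫ := by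
    rw [reg, sum_Icc_one_eq_sum_range, sum_Icc_one_eq_sum_range, sum_Icc_one_eq_sum_range,
      inner_sum, Finset.sum_sub_distrib]
  have hα' := mul_le_mul_of_nonneg_left hsumα
    (by positivity : 0 ≤ n * ((4 + ‖y‖ ^ 2) * (S.G ^ 2 / S.sigmin)))
  have hβ' := mul_le_mul_of_nonneg_left hsumβ (by positivity : 0 ≤ n / 2 * ‖y‖ ^ 2)
  have hγ' := mul_le_mul_of_nonneg_left hsumγ (by positivity : 0 ≤ n * S.B1 ^ 2 / 2)
  have hy' := mul_le_mul_of_nonneg_left hT' (by positivity : 0 ≤ n / 2 * ‖y‖ ^ 2)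
  have hy'' : 0 ≤ n / 2 * ‖y‖ ^ 2 * (T : ℝ) ^ (1 - κ) := by positivity
  have hrhs : S.C11 / κ * (T : ℝ) ^ κ + S.C12 / (1 - κ) * (T : ℝ) ^ (1 - κ) +
      n * S.K * S.dX * ((T : ℝ) + 1) ^ κ +
      n / 2 * (2 * S.G ^ 2 / ((1 - κ) * S.sigmin) + 1 / (1 - κ) + 2) * (T : ℝ) ^ (1 - κ) *
        ‖y‖ ^ 2 =
      ((T : ℝ) + 1) ^ κ * (n * (S.K * S.dX)) +
      n * ((4 + ‖y‖ ^ 2) * (S.G ^ 2 / S.sigmin)) * ((T : ℝ) ^ (1 - κ) / (1 - κ)) +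
      3 * (n : ℝ) ^ 2 * S.tau * S.B1 * S.F / (1 - S.lam) * ((T : ℝ) ^ κ / κ) +
      n * S.B1 ^ 2 / 2 * ((T : ℝ) ^ κ / κ) +
      n / 2 * ‖y‖ ^ 2 * ((T : ℝ) ^ (1 - κ) / (1 - κ)) +
      2 * (n / 2 * ‖y‖ ^ 2 * (T : ℝ) ^ (1 - κ)) := by
    rw [C11, C12, mul_comm (1 - κ) S.sigmin, ← div_div]
    ring
  linarith

end Stepsizes

section Reals

lemma rpow_add_one_le_two_mul {κ : ℝ} (hκ0 : 0 ≤ κ) (hκ1 : κ ≤ 1) {T : ℝ} (hT : 1 ≤ T) :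
    (T + 1) ^ κ ≤ 2 * T ^ κ := by
  calc (T + 1) ^ κ ≤ (2 * T) ^ κ := by gcongr; linarith
    _ = 2 ^ κ * T ^ κ := Real.mul_rpow (by norm_num) (by linarith)
    _ ≤ 2 ^ (1 : ℝ) * T ^ κ := by gcongr; norm_num
    _ = 2 * T ^ κ := by rw [Real.rpow_one]

lemma two_mul_rpow_one_sub_le {κ T : ℝ} (hT : 0 < T) (h : 2 ≤ T ^ κ) :
    2 * T ^ (1 - κ) ≤ T := by
  calc 2 * T ^ (1 - κ) ≤ T ^ κ * T ^ (1 - κ) := by gcongr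
    _ = T := by rw [← Real.rpow_add hT, add_sub_cancel, Real.rpow_one]

end Reals

section MainBounds

variable {n m : ℕ} {p : Fin n → ℕ} {S : Alg n m p} {κ : ℝ}

lemma neg_reg_le (T : ℕ) {z : ∀ i, EuclideanSpace ℝ (Fin (p i))} (hz : ∀ i, z i ∈ S.X i) :
    -S.reg T (fun _ => z) ≤
      T * (n * (2 * S.F + (2 * S.G ^ 2 / S.sigmin + S.K * S.dX / 2))) := by
  have hσ := S.sigmin_pos
  have hagent : ∀ t i, S.f t i (z i) + S.r t i (z i) -
      (S.f t i (S.x t i) + S.r t i (S.x t i)) ≤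
      2 * S.F + (2 * S.G ^ 2 / S.sigmin + S.K * S.dX / 2) := by
    intro t i
    have h1 := S.cost_sub_le t (S.x_mem t i) (hz i)
    have h2 := S.norm_sub_le_dX (S.x_mem t) hz i
    have h3 := (S.sigmin_mul_le_breg (S.x_mem t i) (hz i)).trans (S.breg_le (S.x_mem t i) (hz i))
    have h4 := mul_le_mul_of_nonneg_left h2 S.hK.le
    set δ := ‖S.x t i - z i‖
    have hyoung : S.G * δ ≤ 2 * S.G ^ 2 / S.sigmin + S.sigmin / 4 * δ ^ 2 := by
      have h : 2 * S.G ^ 2 / S.sigmin + S.sigmin / 4 * δ ^ 2 - S.G * δ =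
          ((2 * S.G - S.sigmin * δ) ^ 2 + 4 * S.G ^ 2) / (4 * S.sigmin) := by
        field_simp
        ring
      have : 0 ≤ ((2 * S.G - S.sigmin * δ) ^ 2 + 4 * S.G ^ 2) / (4 * S.sigmin) := by positivity
      linarith
    linarith
  have hstep : ∀ t, S.fsum t z - S.fsum t (S.x t) ≤
      n * (2 * S.F + (2 * S.G ^ 2 / S.sigmin + S.K * S.dX / 2)) := by
    intro t
    have := Finset.sum_le_sum fun i (_ : i ∈ Finset.univ) => hagent t i
    rwa [Finset.sum_sub_distrib, Finset.sum_const, Finset.card_univ, Fintype.card_fin,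
      nsmul_eq_mul] at this
  have := Finset.sum_le_sum fun t (_ : t ∈ Finset.Icc 1 T) => hstep t
  rw [Finset.sum_sub_distrib, Finset.sum_const, Nat.card_Icc, add_tsub_cancel_right,
    nsmul_eq_mul] at this
  rwa [reg, neg_sub]

lemma violation_le (T : ℕ) : S.violation T ≤ n * S.F * T := by
  have h1 := norm_posPart_sub_le (∑ t ∈ Finset.Icc 1 T, S.gsum t (S.x t)) (v := 0) (by simp)
  simp only [sub_zero] at h1
  have h2 : ∀ t ∈ Finset.Icc 1 T, ‖S.gsum t (S.x t)‖ ≤ n * S.F := fun t _ => by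
    simpa [gsum] using norm_sum_le_of_le Finset.univ fun i _ => S.hgbound t i _ (S.x_mem t i)
  have h3 := norm_sum_le_of_le _ h2
  rw [Finset.sum_const, Nat.card_Icc, add_tsub_cancel_right, nsmul_eq_mul] at h3
  rw [violation]
  linarith

/-- Choosing the dual comparator optimally bounds the violation. -/
lemma violation_sq_le {T : ℕ} {R A : ℝ} (hA : 0 < A)
    (h : ∀ y : EuclideanSpace ℝ (Fin m), (∀ j, 0 ≤ y j) →
      ⟪y, ∑ t ∈ Finset.Icc 1 T, S.gsum t (S.x t)⟫ ≤ R + A * ‖y‖ ^ 2) :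
    S.violation T ^ 2 ≤ 4 * A * R := by
  set v := ∑ t ∈ Finset.Icc 1 T, S.gsum t (S.x t) with hv
  have h1 := h ((2 * A)⁻¹ • posPart v) fun j => by
    simp only [PiLp.smul_apply, smul_eq_mul, posPart_apply]
    positivity
  rw [real_inner_smul_left, inner_posPart_self, norm_smul, Real.norm_of_nonneg (by positivity)]
    at h1
  have hviol : S.violation T = ‖posPart v‖ := rfl
  rw [hviol]
  have h2 := mul_le_mul_of_nonneg_left h1 (by positivity : 0 ≤ 4 * A)
  have e1 : 4 * A * ((2 * A)⁻¹ * ‖posPart v‖ ^ 2) = 2 * ‖posPart v‖ ^ 2 := by field_simp; ring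
  have e2 : 4 * A * (R + A * ((2 * A)⁻¹ * ‖posPart v‖) ^ 2) =
      4 * A * R + ‖posPart v‖ ^ 2 := by field_simp; ring
  rw [e1, e2] at h2
  linarith

/-- Sublinear regret against a static feasible comparator. -/
lemma reg_le (hΦid : ∀ t i z, S.Φ t i z = z) (hκ0 : 0 < κ) (hκ1 : κ < 1)
    (hα : ∀ t : ℕ, 1 ≤ t → S.α t = ((t : ℝ) ^ κ)⁻¹)
    (hβ : ∀ t : ℕ, 1 ≤ t → S.β t = ((t : ℝ) ^ κ)⁻¹)
    (hγ : ∀ t : ℕ, 1 ≤ t → S.γ t = ((t : ℝ) ^ (1 - κ))⁻¹) {T : ℕ} (hT : 1 ≤ T)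
    {z : ∀ i, EuclideanSpace ℝ (Fin (p i))} (hz : ∀ i, z i ∈ S.X i)
    (hfeas : ∀ t ∈ Finset.Icc 1 T, ∀ j, S.gsum t z j ≤ 0) :
    S.reg T (fun _ => z) ≤ (S.C11 / κ + S.C12 / (1 - κ) + 2 * (n : ℝ) * S.dX * S.K) *
      (T : ℝ) ^ max (1 - κ) κ := by
  have h := regret_add_inner_le hΦid hκ0 hκ1 hα hβ hγ hT hz hfeas (y := 0) (by simp)
  simp only [inner_zero_left, norm_zero] at h
  have hT' : (1 : ℝ) ≤ T := by exact_mod_cast hT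
  have hC11 : 0 ≤ S.C11 := le_trans (by positivity) S.half_mul_B1_sq_le_C11
  have hC12 := S.C12_nonneg
  have hκ1' : 0 < 1 - κ := sub_pos.2 hκ1
  have hK := S.hK
  have hd := S.hdX
  have h1 := mul_le_mul_of_nonneg_left
    (Real.rpow_le_rpow_of_exponent_le hT' (le_max_right (1 - κ) κ))
    (by positivity : 0 ≤ S.C11 / κ)
  have h2 := mul_le_mul_of_nonneg_left
    (Real.rpow_le_rpow_of_exponent_le hT' (le_max_left (1 - κ) κ))
    (by positivity : 0 ≤ S.C12 / (1 - κ))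
  have h3 := mul_le_mul_of_nonneg_left
    ((rpow_add_one_le_two_mul hκ0.le hκ1.le hT').trans (mul_le_mul_of_nonneg_left
    (Real.rpow_le_rpow_of_exponent_le hT' (le_max_right (1 - κ) κ)) zero_le_two))
    (by positivity : 0 ≤ n * S.K * S.dX)
  linarith

lemma violation_sq_le_of_two_le_rpow (hΦid : ∀ t i z, S.Φ t i z = z) (hκ0 : 0 < κ) (hκ1 : κ < 1)
    (hα : ∀ t : ℕ, 1 ≤ t → S.α t = ((t : ℝ) ^ κ)⁻¹)
    (hβ : ∀ t : ℕ, 1 ≤ t → S.β t = ((t : ℝ) ^ κ)⁻¹)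
    (hγ : ∀ t : ℕ, 1 ≤ t → S.γ t = ((t : ℝ) ^ (1 - κ))⁻¹) {T : ℕ} (hT : 1 ≤ T)
    {z : ∀ i, EuclideanSpace ℝ (Fin (p i))} (hz : ∀ i, z i ∈ S.X i)
    (hfeas : ∀ t ∈ Finset.Icc 1 T, ∀ j, S.gsum t z j ≤ 0) (hTκ : 2 ≤ (T : ℝ) ^ κ) :
    S.violation T ^ 2 ≤
      (2 * (n : ℝ) * (2 * S.G ^ 2 / ((1 - κ) * S.sigmin) + 1 / (1 - κ) + 2)) *
        (2 * (n : ℝ) * S.F + (S.C11 / κ + S.C12 / (1 - κ) + 2 * (n : ℝ) * S.dX * S.K)) *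
        ((T : ℝ) * (T : ℝ) ^ (1 - κ)) := by
  have hT' : (1 : ℝ) ≤ T := by exact_mod_cast hT
  have hn : (0 : ℝ) < n := by exact_mod_cast S.hn
  have hC11 : 0 ≤ S.C11 := le_trans (by positivity) S.half_mul_B1_sq_le_C11
  have hC12 := S.C12_nonneg
  have hκ1' : 0 < 1 - κ := sub_pos.2 hκ1
  have hK := S.hK
  have hd := S.hdX
  have hσ := S.sigmin_pos
  have hPT : (T : ℝ) ^ κ ≤ T := Real.rpow_le_self_of_one_le hT' hκ1.le
  have hQ := two_mul_rpow_one_sub_le (by linarith) hTκ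
  have hT1 : ((T : ℝ) + 1) ^ κ ≤ T + 1 := Real.rpow_le_self_of_one_le (by linarith) hκ1.le
  have hreg := neg_reg_le T hz
  set B := 2 * S.G ^ 2 / ((1 - κ) * S.sigmin) + 1 / (1 - κ) + 2 with hB
  have hB0 : 0 < B := by positivity
  have hQ0 : 0 < (T : ℝ) ^ (1 - κ) := by positivity
  have hviol := violation_sq_le (S := S) (T := T)
    (R := S.C11 / κ * (T : ℝ) ^ κ + S.C12 / (1 - κ) * (T : ℝ) ^ (1 - κ) +
      n * S.K * S.dX * ((T : ℝ) + 1) ^ κ - S.reg T (fun _ => z))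
    (A := n / 2 * B * (T : ℝ) ^ (1 - κ)) (by positivity) fun y hy => by
      have := regret_add_inner_le hΦid hκ0 hκ1 hα hβ hγ hT hz hfeas hy
      linarith
  refine hviol.trans ?_
  have h1 := mul_le_mul_of_nonneg_left hPT (by positivity : 0 ≤ S.C11 / κ)
  have h2 := mul_le_mul_of_nonneg_left hQ (by positivity : 0 ≤ S.C12 / (1 - κ) / 2)
  have h3 := mul_le_mul_of_nonneg_left (hT1.trans (by linarith : (T : ℝ) + 1 ≤ 3 / 2 * T))
    (by positivity : 0 ≤ n * S.K * S.dX)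
  have h4 : T * (n * (2 * S.G ^ 2 / S.sigmin)) ≤ S.C12 / (1 - κ) / 2 * (T : ℝ) := by
    have : S.C12 ≤ S.C12 / (1 - κ) := le_div_self hC12 hκ1' (by linarith)
    have h5 := mul_le_mul_of_nonneg_right this (by linarith : (0 : ℝ) ≤ T)
    have h6 : T * (n * (2 * S.G ^ 2 / S.sigmin)) = S.C12 * T / 2 := by rw [C12]; ring
    linarith
  have hR : S.C11 / κ * (T : ℝ) ^ κ + S.C12 / (1 - κ) * (T : ℝ) ^ (1 - κ) +
      n * S.K * S.dX * ((T : ℝ) + 1) ^ κ - S.reg T (fun _ => z) ≤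
      (2 * (n : ℝ) * S.F + (S.C11 / κ + S.C12 / (1 - κ) + 2 * (n : ℝ) * S.dX * S.K)) * T := by
    linarith
  have h7 := mul_le_mul_of_nonneg_left hR
    (by positivity : 0 ≤ 4 * (n / 2 * B * (T : ℝ) ^ (1 - κ)))
  linarith

lemma violation_sq_le_of_rpow_le_two (hκ0 : 0 < κ) (hκ1 : κ < 1) {T : ℕ} (hT : 1 ≤ T)
    (hTκ : (T : ℝ) ^ κ ≤ 2) :
    S.violation T ^ 2 ≤
      (2 * (n : ℝ) * (2 * S.G ^ 2 / ((1 - κ) * S.sigmin) + 1 / (1 - κ) + 2)) *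
        (2 * (n : ℝ) * S.F + (S.C11 / κ + S.C12 / (1 - κ) + 2 * (n : ℝ) * S.dX * S.K)) *
        ((T : ℝ) * (T : ℝ) ^ (1 - κ)) := by
  have hT0 : (0 : ℝ) < T := by exact_mod_cast hT
  have hκ1' : 0 < 1 - κ := sub_pos.2 hκ1
  have hF := S.hF
  have hK := S.hK
  have hd := S.hdX
  have hG := S.hG
  have hσ := S.sigmin_pos
  have hC12 := S.C12_nonneg
  have hB1 : 2 * S.F ≤ S.B1 := by
    have := mul_pos hG hd
    unfold B1
    linarith
  have hC11 : n * (2 * S.F) ^ 2 / 2 ≤ S.C11 := le_trans (by gcongr) S.half_mul_B1_sq_le_C11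
  have hC11' : S.C11 ≤ S.C11 / κ := le_div_self (le_trans (by positivity) hC11) hκ0 hκ1.le
  have hfirst : 2 * (n : ℝ) * 1 ≤
      2 * (n : ℝ) * (2 * S.G ^ 2 / ((1 - κ) * S.sigmin) + 1 / (1 - κ) + 2) := by
    gcongr
    have : 0 ≤ 2 * S.G ^ 2 / ((1 - κ) * S.sigmin) + 1 / (1 - κ) := by positivity
    linarith
  have hsecond : 2 * (n : ℝ) * S.F ^ 2 ≤
      2 * (n : ℝ) * S.F + (S.C11 / κ + S.C12 / (1 - κ) + 2 * (n : ℝ) * S.dX * S.K) := by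
    have h1 : 0 ≤ 2 * (n : ℝ) * S.F := by positivity
    have h2 : 0 ≤ S.C12 / (1 - κ) := by positivity
    have h3 : 0 ≤ 2 * (n : ℝ) * S.dX * S.K := by positivity
    linarith
  have hTT : (T : ℝ) ≤ 2 * (T : ℝ) ^ (1 - κ) := by
    calc (T : ℝ) = (T : ℝ) ^ κ * (T : ℝ) ^ (1 - κ) := by
          rw [← Real.rpow_add hT0, add_sub_cancel, Real.rpow_one]
      _ ≤ 2 * (T : ℝ) ^ (1 - κ) := by gcongr
  have hviol : 0 ≤ S.violation T := norm_nonneg _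
  calc S.violation T ^ 2 ≤ (n * S.F * T) ^ 2 := pow_le_pow_left₀ hviol (violation_le T) 2
    _ = n ^ 2 * S.F ^ 2 * (T * T) := by ring
    _ ≤ n ^ 2 * S.F ^ 2 * (T * (2 * (T : ℝ) ^ (1 - κ))) := by gcongr
    _ ≤ (2 * (n : ℝ) * 1) * (2 * (n : ℝ) * S.F ^ 2) * (T * (T : ℝ) ^ (1 - κ)) := by
      have : 0 ≤ (n : ℝ) ^ 2 * S.F ^ 2 * (T * (T : ℝ) ^ (1 - κ)) := by positivity
      linarith
    _ ≤ _ := by gcongr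

end MainBounds

end Alg

theorem statement_12 {n m : ℕ} {p : Fin n → ℕ} (S : Alg n m p)
    (hΦid : ∀ t i (z : EuclideanSpace ℝ (Fin (p i))), S.Φ t i z = z)
    (κ : ℝ) (hκ0 : 0 < κ) (hκ1 : κ < 1)
    (hα : ∀ t : ℕ, 1 ≤ t → S.α t = ((t : ℝ) ^ κ)⁻¹)
    (hβ : ∀ t : ℕ, 1 ≤ t → S.β t = ((t : ℝ) ^ κ)⁻¹)
    (hγ : ∀ t : ℕ, 1 ≤ t → S.γ t = ((t : ℝ) ^ (1 - κ))⁻¹)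
    (T : ℕ) (hT : 1 ≤ T)
    (xc : ∀ i, EuclideanSpace ℝ (Fin (p i))) (hxcmem : ∀ i, xc i ∈ S.X i)
    (hxcfeas : ∀ t ∈ Finset.Icc 1 T, ∀ j, S.gsum t xc j ≤ 0)
    (hxcopt : ∀ z : ∀ i, EuclideanSpace ℝ (Fin (p i)), (∀ i, z i ∈ S.X i) →
      (∀ t ∈ Finset.Icc 1 T, ∀ j, S.gsum t z j ≤ 0) →
      ∑ t ∈ Finset.Icc 1 T, S.fsum t xc ≤ ∑ t ∈ Finset.Icc 1 T, S.fsum t z) :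
    S.reg T (fun _ => xc) ≤ (S.C11 / κ + S.C12 / (1 - κ) + 2 * (n : ℝ) * S.dX * S.K) * (T : ℝ) ^ max (1 - κ) κ
    ∧ S.violation T ≤
        Real.sqrt ((2 * (n : ℝ) * (2 * S.G ^ 2 / ((1 - κ) * S.sigmin) + 1 / (1 - κ) + 2)) * (2 * (n : ℝ) * S.F + (S.C11 / κ + S.C12 / (1 - κ) + 2 * (n : ℝ) * S.dX * S.K))) * (T : ℝ) ^ (1 - κ / 2) := by
  refine ⟨Alg.reg_le hΦid hκ0 hκ1 hα hβ hγ hT hxcmem hxcfeas, ?_⟩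
  have hT0 : (0 : ℝ) < T := by exact_mod_cast hT
  have hsq := (le_total 2 ((T : ℝ) ^ κ)).elim
    (Alg.violation_sq_le_of_two_le_rpow hΦid hκ0 hκ1 hα hβ hγ hT hxcmem hxcfeas)
    (Alg.violation_sq_le_of_rpow_le_two (S := S) hκ0 hκ1 hT)
  have hpow : (T : ℝ) * (T : ℝ) ^ (1 - κ) = ((T : ℝ) ^ (1 - κ / 2)) ^ 2 := by
    rw [← Real.rpow_natCast, ← Real.rpow_mul hT0.le, ← Real.rpow_one_add' hT0.le (by linarith)]
    congr 1
    push_cast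
    ring
  rw [hpow] at hsq
  refine (Real.le_sqrt_of_sq_le hsq).trans_eq ?_
  rw [Real.sqrt_mul' _ (by positivity), Real.sqrt_sq (by positivity)]

end
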